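/- arXiv:2010.16289 — 2 statements merged into one kernel-verified Lean document; each statement's English description precedes it below -/
import Mathlib

section
/- (Log-Sobolev inequality for the multislice.) For every function f : Ω_κ → ℝ, Ent_{P_κ}(f²) ≤ (4 log(N/κ_min) / log 2) · E_κ[ Γ(f)² ], where κ_min = min{κ_1,…,κ_L}; i.e. P_κ satisfies a Γ-LSI with constant σ² = 2 log(N/κ_min)/log 2. -/
open Finset Real
open scoped Classical

noncomputable section

/-- The multislice `Ω_κ ⊆ 𝒳^N`: vectors with values in `{x ℓ}` where the value `x ℓ`
appears exactly `κ ℓ` times. -/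
def multislice (L N : ℕ) (κ : Fin L → ℕ) (x : Fin L → ℝ) : Finset (Fin N → ℝ) :=
  (Fintype.piFinset fun _ : Fin N => Finset.image x Finset.univ).filter
    (fun ω => ∀ ℓ : Fin L, (Finset.univ.filter fun i => ω i = x ℓ).card = κ ℓ)

/-- Expectation with respect to the uniform distribution on a finite set. -/
def uexpect {α : Type*} (Ω : Finset α) (f : α → ℝ) : ℝ := (∑ ω ∈ Ω, f ω) / Ω.card

/-- Probability of an event with respect to the uniform distribution on a finite set. -/
def uprob {α : Type*} (Ω : Finset α) (p : α → Prop) : ℝ :=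
  ((Ω.filter p).card : ℝ) / Ω.card

/-- The entropy functional `Ent_μ(g) = E_μ[g log g] − (E_μ g) log (E_μ g)` with respect to
the uniform distribution on a finite set. -/
def uent {α : Type*} (Ω : Finset α) (g : α → ℝ) : ℝ :=
  uexpect Ω (fun ω => g ω * Real.log (g ω)) - uexpect Ω g * Real.log (uexpect Ω g)

/-- `Γ(f)² (ω) = (1/(2N)) ∑_{i<j} (f(ω) − f(τ_ij ω))²`. -/
def gammaSq {N : ℕ} (f : (Fin N → ℝ) → ℝ) (ω : Fin N → ℝ) : ℝ :=
  (1 / (2 * (N : ℝ))) * ∑ q ∈ (Finset.univ : Finset (Fin N × Fin N)).filter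
    (fun q => q.1 < q.2), (f ω - f (ω ∘ Equiv.swap q.1 q.2)) ^ 2

/-- `Γ⁺(f)² (ω) = (1/(2N)) ∑_{i<j} ((f(ω) − f(τ_ij ω))₊)²`. -/
def gammaPlusSq {N : ℕ} (f : (Fin N → ℝ) → ℝ) (ω : Fin N → ℝ) : ℝ :=
  (1 / (2 * (N : ℝ))) * ∑ q ∈ (Finset.univ : Finset (Fin N × Fin N)).filter
    (fun q => q.1 < q.2), (max (f ω - f (ω ∘ Equiv.swap q.1 q.2)) 0) ^ 2

theorem hyperbolic_comparison {c ρ : ℝ} (hc : 0 ≤ c) (hρc : ρ * sinh c = c)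
    (hlow : ∀ z, 0 ≤ z → z ≤ c → ρ * sinh z ≤ z) (hhigh : ∀ z, c ≤ z → z ≤ ρ * sinh z) (z : ℝ) :
    z * sinh z - cosh z * (log (cosh z) - log (cosh c)) ≤ ρ * (cosh z * cosh c - 1) := by
  wlog hz : 0 ≤ z generalizing z
  · simpa using this (-z) (by linarith)
  let D : ℝ → ℝ := fun z =>
    ρ * cosh c - ρ / cosh z - z * (sinh z / cosh z) + log (cosh z) - log (cosh c)
  have hD : ∀ z, HasDerivAt D ((ρ * sinh z - z) / cosh z ^ 2) z := by
    intro z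
    have hz := (cosh_pos z).ne'
    have h1 := (hasDerivAt_const z ρ).div (hasDerivAt_cosh z) hz
    have h2 := (hasDerivAt_id z).mul ((hasDerivAt_sinh z).div (hasDerivAt_cosh z) hz)
    have h3 := (hasDerivAt_cosh z).log hz
    have h := ((((hasDerivAt_const z (ρ * cosh c)).sub h1).sub h2).add h3).sub_const (log (cosh c))
    refine h.congr_deriv ?_
    have := cosh_sq z
    simp only [id, Pi.div_apply]
    field_simp
    rw [this]
    ring
  have hcont : Continuous D := continuous_iff_continuousAt.2 fun z => (hD z).continuousAt
  have hDc : D c = 0 := by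
    have h := (cosh_pos c).ne'
    have hs := cosh_sq c
    simp only [D]
    have : ρ * cosh c - ρ / cosh c - c * (sinh c / cosh c) = 0 := by
      field_simp
      rw [hs]
      linear_combination sinh c * hρc
    linarith
  have hDz : 0 ≤ D z := by
    rcases le_total z c with h | h
    · have : AntitoneOn D (Set.Icc 0 c) := by
        refine antitoneOn_of_deriv_nonpos (convex_Icc _ _) hcont.continuousOn
          (fun y _ => (hD y).differentiableAt.differentiableWithinAt) fun y hy => ?_
        rw [interior_Icc] at hy
        rw [(hD y).deriv]
        exact div_nonpos_of_nonpos_of_nonneg (by linarith [hlow y hy.1.le hy.2.le]) (sq_nonneg _)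
      have := this ⟨hz, h⟩ ⟨hc, le_rfl⟩ h
      linarith
    · have : MonotoneOn D (Set.Ici c) := by
        refine monotoneOn_of_deriv_nonneg (convex_Ici _) hcont.continuousOn
          (fun y _ => (hD y).differentiableAt.differentiableWithinAt) fun y hy => ?_
        rw [interior_Ici] at hy
        rw [(hD y).deriv]
        exact div_nonneg (by linarith [hhigh y (le_of_lt hy)]) (sq_nonneg _)
      have := this (Set.mem_Ici.2 le_rfl) (Set.mem_Ici.2 h) h
      linarith
  have hp := cosh_pos z
  have key : cosh z * D z = ρ * (cosh z * cosh c - 1)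
      - (z * sinh z - cosh z * (log (cosh z) - log (cosh c))) := by
    simp only [D]
    field_simp
    ring
  nlinarith [mul_nonneg hp.le hDz]

theorem mul_log_two_le_log_cosh_mul_tanh {c : ℝ} (hc : 0 ≤ c) :
    c * log 2 ≤ (log 2 + log (cosh c)) * (sinh c / cosh c) := by
  let φ : ℝ → ℝ := fun c => (log 2 + log (cosh c)) * (sinh c / cosh c) - c * log 2
  have hφ : ∀ z, HasDerivAt φ ((sinh z / cosh z) ^ 2 * (1 - log 2)
      + log (cosh z) / cosh z ^ 2) z := by
    intro z
    have hz := (cosh_pos z).ne'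
    have h1 := ((hasDerivAt_cosh z).log hz).const_add (log 2)
    have h := (h1.mul ((hasDerivAt_sinh z).div (hasDerivAt_cosh z) hz)).sub
      ((hasDerivAt_id z).mul_const (log 2))
    refine h.congr_deriv ?_
    have := cosh_sq z
    simp only [Pi.div_apply]
    field_simp
    rw [this]
    ring
  have hcont : Continuous φ := continuous_iff_continuousAt.2 fun z => (hφ z).continuousAt
  have hmono : MonotoneOn φ (Set.Ici 0) := by
    refine monotoneOn_of_deriv_nonneg (convex_Ici _) hcont.continuousOn
      (fun y _ => (hφ y).differentiableAt.differentiableWithinAt) fun y _ => ?_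
    rw [(hφ y).deriv]
    have h2 : log 2 ≤ 1 := by linarith [log_two_lt_d9]
    have := log_nonneg (one_le_cosh y)
    have : 0 ≤ 1 - log 2 := by linarith
    positivity
  have := hmono (Set.mem_Ici.2 le_rfl) (Set.mem_Ici.2 hc) hc
  simp only [φ] at this
  simp at this
  linarith

theorem exists_sinh_slope {c : ℝ} (hc : 0 ≤ c) :
    ∃ ρ : ℝ, 0 ≤ ρ ∧ ρ * sinh c = c ∧ (∀ z, 0 ≤ z → z ≤ c → ρ * sinh z ≤ z) ∧
      (∀ z, c ≤ z → z ≤ ρ * sinh z) ∧ ρ * cosh c * log 2 ≤ log 2 + log (cosh c) := by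
  rcases hc.eq_or_lt with rfl | hc
  · refine ⟨1, zero_le_one, by simp, fun z h0 h1 => ?_, fun z hz => ?_, by simp⟩
    · obtain rfl := le_antisymm h1 h0
      simp
    · simpa using self_le_sinh_iff.2 hz
  · have hs := sinh_pos_iff.2 hc
    have hconv : ConvexOn ℝ (Set.Ici 0) sinh := by
      refine MonotoneOn.convexOn_of_deriv (convex_Ici 0) continuous_sinh.continuousOn
        differentiable_sinh.differentiableOn ?_
      rw [Real.deriv_sinh]
      intro x hx y hy hxy
      rw [interior_Ici] at hx hy
      exact cosh_le_cosh.2 (by rwa [abs_of_pos hx, abs_of_pos hy])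
    have hscale : ∀ u v : ℝ, 0 ≤ u → u ≤ v → v * sinh u ≤ u * sinh v := by
      intro u v hu huv
      rcases (hu.trans huv).eq_or_lt with h | hv
      · obtain rfl := h
        obtain rfl := le_antisymm huv hu
        simp
      · have h1 : 0 ≤ 1 - u / v := by rw [sub_nonneg, div_le_one hv]; exact huv
        have h2 : 0 ≤ u / v := by positivity
        have := hconv.2 (Set.mem_Ici.2 le_rfl) (Set.mem_Ici.2 hv.le) h1 h2 (by ring)
        simp only [smul_eq_mul, mul_zero, zero_add, sinh_zero, div_mul_cancel₀ u hv.ne'] at this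
        rw [div_mul_eq_mul_div, le_div_iff₀ hv] at this
        linarith
    refine ⟨c / sinh c, by positivity, div_mul_cancel₀ _ hs.ne', fun z h0 h1 => ?_,
      fun z hz => ?_, ?_⟩
    · rw [div_mul_eq_mul_div, div_le_iff₀ hs]
      exact hscale z c h0 h1
    · rw [div_mul_eq_mul_div, le_div_iff₀ hs]
      linarith [hscale c z hc.le hz]
    · have h := mul_log_two_le_log_cosh_mul_tanh hc.le
      have hch := cosh_pos c
      rw [← mul_div_assoc, le_div_iff₀ hch] at h
      rw [div_mul_eq_mul_div, div_mul_eq_mul_div, div_le_iff₀ hs]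
      linarith

/-- Logarithmic Sobolev inequality on two points. -/
theorem two_point_logSobolev_of_pos {p q x y : ℝ} (hp : 0 < p) (hq : 0 < q) (hpq : p + q = 1)
    (hx : 0 < x) (hy : 0 < y) :
    p * (x ^ 2 * log (x ^ 2)) + q * (y ^ 2 * log (y ^ 2))
      - (p * x ^ 2 + q * y ^ 2) * log (p * x ^ 2 + q * y ^ 2)
      ≤ log (1 / (p * q)) / log 2 * (p * q * (x - y) ^ 2) := by
  wlog hle : p ≤ q generalizing p q x y
  · have := this hq hp (by linarith) hy hx (by linarith)
    rw [add_comm (p * x ^ 2), mul_comm p q]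
    linarith [this, sub_sq_comm x y,
      congrArg (fun t => log (1 / (q * p)) / log 2 * (q * p * t)) (sub_sq_comm x y)]
  set c := (log q - log p) / 2 with hc_def
  have hc : 0 ≤ c := by
    have := log_le_log hp hle
    simp only [hc_def]; linarith
  obtain ⟨ρ, hρ0, hρc, hlow, hhigh, hρlog⟩ := exists_sinh_slope hc
  set z := log x - log y - c with hz_def
  have hkey := hyperbolic_comparison hc hρc hlow hhigh z
  have hC := cosh_pos c
  have hZ := cosh_pos z
  have hec : exp c * exp c * p = q := by
    rw [← exp_add, show c + c = log q - log p by simp only [hc_def]; ring, exp_sub, exp_log hp,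
      exp_log hq]
    field_simp
  have hexy : exp z * exp c * y = x := by
    rw [← exp_add, show z + c = log x - log y by simp only [hz_def]; ring, exp_sub, exp_log hx,
      exp_log hy]
    field_simp
  have hp' : p * (exp c * (2 * cosh c)) = 1 := by
    have : exp c * exp (-c) = 1 := by rw [← exp_add]; simp
    rw [cosh_eq]
    linear_combination hpq + hec + p * this
  have hlogx : log x = z + c + log y := by simp only [hz_def]; ring
  set K := exp c * exp z * y ^ 2 / cosh c with hK_def
  have hK : 0 < K := by positivity
  have hp_eq : p = 1 / (exp c * (2 * cosh c)) := by
    rw [eq_div_iff (by positivity)]; exact hp'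
  have hpx : p * x ^ 2 = K * exp z / 2 := by
    rw [← hexy, hp_eq, hK_def]
    field_simp
  have hqy : q * y ^ 2 = K * exp (-z) / 2 := by
    rw [← hec, hp_eq, hK_def, exp_neg]
    field_simp
  have hm : p * x ^ 2 + q * y ^ 2 = K * cosh z := by
    rw [hpx, hqy, cosh_eq]; ring
  have hlogK : log K = c + z + 2 * log y - log (cosh c) := by
    rw [hK_def, log_div (by positivity) hC.ne', log_mul (by positivity) (by positivity),
      log_mul (by positivity) (by positivity), log_exp, log_exp, log_pow]
    push_cast; ring
  have hpq_eq : p * q = 1 / (4 * cosh c ^ 2) := by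
    rw [← hec, hp_eq]
    field_simp
    ring
  have hvar : p * q * (x - y) ^ 2 = K / (2 * cosh c) * (cosh (z + c) - 1) := by
    rw [hpq_eq, ← hexy, hK_def, cosh_eq (z + c), neg_add, exp_add, exp_add, exp_neg, exp_neg]
    field_simp
    ring
  have hlog : log (1 / (p * q)) = 2 * (log 2 + log (cosh c)) := by
    rw [hpq_eq, one_div_one_div, show 4 * cosh c ^ 2 = (2 * cosh c) ^ 2 by ring, log_pow,
      log_mul two_ne_zero hC.ne']
    push_cast; ring
  have h2 : 0 < log 2 := log_pos one_lt_two
  have hconst : 2 * (ρ * cosh c) ≤ log (1 / (p * q)) / log 2 := by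
    rw [le_div_iff₀ h2, hlog]
    linarith
  have hlhs : p * (x ^ 2 * log (x ^ 2)) + q * (y ^ 2 * log (y ^ 2))
      - (p * x ^ 2 + q * y ^ 2) * log (p * x ^ 2 + q * y ^ 2)
      = K * ((z + c) * sinh z - cosh z * (log (cosh z) - log (cosh c))) := by
    rw [← mul_assoc, ← mul_assoc, hm, hpx, hqy, log_mul hK.ne' hZ.ne', hlogK, log_pow, log_pow,
      hlogx, cosh_eq z, sinh_eq z]
    push_cast; ring
  have hvar0 : 0 ≤ p * q * (x - y) ^ 2 := by positivity
  calc _ = K * ((z + c) * sinh z - cosh z * (log (cosh z) - log (cosh c))) := hlhs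
    _ ≤ K * (ρ * (cosh (z + c) - 1)) := by
        refine mul_le_mul_of_nonneg_left ?_ hK.le
        rw [cosh_add]
        linear_combination hkey - sinh z * hρc
    _ = 2 * (ρ * cosh c) * (p * q * (x - y) ^ 2) := by
        rw [hvar]; field_simp
    _ ≤ _ := mul_le_mul_of_nonneg_right hconst hvar0

theorem two_point_logSobolev {p q x y : ℝ} (hp : 0 < p) (hq : 0 < q) (hpq : p + q = 1)
    (hx : 0 ≤ x) (hy : 0 ≤ y) :
    p * (x ^ 2 * log (x ^ 2)) + q * (y ^ 2 * log (y ^ 2))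
      - (p * x ^ 2 + q * y ^ 2) * log (p * x ^ 2 + q * y ^ 2)
      ≤ log (1 / (p * q)) / log 2 * (p * q * (x - y) ^ 2) := by
  let F : ℝ → ℝ := fun ε => p * ((x + ε) ^ 2 * log ((x + ε) ^ 2))
    + q * ((y + ε) ^ 2 * log ((y + ε) ^ 2))
    - (p * (x + ε) ^ 2 + q * (y + ε) ^ 2) * log (p * (x + ε) ^ 2 + q * (y + ε) ^ 2)
  have hF : Continuous F := by
    have h1 : ∀ t : ℝ, Continuous fun ε : ℝ => (t + ε) ^ 2 * log ((t + ε) ^ 2) := fun t =>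
      continuous_mul_log.comp (by fun_prop : Continuous fun ε : ℝ => (t + ε) ^ 2)
    have h2 := continuous_mul_log.comp
      (by fun_prop : Continuous fun ε : ℝ => p * (x + ε) ^ 2 + q * (y + ε) ^ 2)
    exact (((h1 x).const_mul p).add ((h1 y).const_mul q)).sub h2
  have hlim : Filter.Tendsto F (nhdsWithin 0 (Set.Ioi 0)) (nhds (F 0)) :=
    hF.continuousAt.tendsto.mono_left nhdsWithin_le_nhds
  have := le_of_tendsto hlim (b := log (1 / (p * q)) / log 2 * (p * q * (x - y) ^ 2)) <| by
    filter_upwards [self_mem_nhdsWithin] with ε hε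
    have hε : 0 < ε := hε
    have := two_point_logSobolev_of_pos hp hq hpq (add_pos_of_nonneg_of_pos hx hε)
      (add_pos_of_nonneg_of_pos hy hε)
    rwa [add_sub_add_right_eq_sub] at this
  simpa only [F, add_zero] using this

theorem log_le_half_sub_inv {t : ℝ} (ht : 1 ≤ t) : log t ≤ (t - t⁻¹) / 2 := by
  have h := self_le_sinh_iff.2 (log_nonneg ht)
  have h0 : 0 < t := by linarith
  rwa [sinh_eq, exp_neg, exp_log h0] at h

/-- Up to the factor `1 / log 2`, the logarithmic Sobolev constant of the two-coloured slice. -/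
def sliceLog (a b : ℝ) : ℝ := log ((a + b) ^ 2 / (a * b))

theorem sliceLog_nonneg {a b : ℝ} (ha : 0 ≤ a) (hb : 0 ≤ b) : 0 ≤ sliceLog a b := by
  rcases ha.eq_or_lt with rfl | ha
  · simp [sliceLog]
  rcases hb.eq_or_lt with rfl | hb
  · simp [sliceLog]
  refine log_nonneg ?_
  rw [le_div_iff₀ (by positivity)]
  nlinarith [mul_pos ha hb, sq_nonneg a, sq_nonneg b]

theorem sliceLog_comm (a b : ℝ) : sliceLog a b = sliceLog b a := by
  simp only [sliceLog, add_comm a b, mul_comm a b]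

theorem log_four_le_sliceLog {a b : ℝ} (ha : 0 < a) (hb : 0 < b) : 2 * log 2 ≤ sliceLog a b := by
  have : 2 * log 2 = log (2 ^ 2) := by rw [log_pow]; push_cast; ring
  rw [this]
  refine log_le_log (by norm_num) ?_
  rw [le_div_iff₀ (by positivity)]
  nlinarith [sq_nonneg (a - b)]

theorem sliceLog_sub_one {a b : ℝ} (ha : 1 < a) (hb : 0 < b) :
    sliceLog (a - 1) b
      = sliceLog a b - 2 * log ((a + b) / (a + b - 1)) + log (a / (a - 1)) := by
  have h1 : 0 < a - 1 := by linarith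
  have h2 : 0 < a + b - 1 := by linarith
  have h3 : 0 < a := by linarith
  have h4 : 0 < a + b := by linarith
  rw [sliceLog, sliceLog, show a - 1 + b = a + b - 1 by ring,
    log_div (by positivity) (by positivity),
    log_div (by positivity) (by positivity), log_div (by positivity) (by positivity),
    log_div (by positivity) (by positivity), log_mul (by positivity) (by positivity),
    log_mul (by positivity) (by positivity), log_pow, log_pow]
  push_cast
  ring

theorem sub_one_mul_log_le {a : ℝ} (ha : 1 < a) :
    (a - 1) * log (a / (a - 1)) ≤ 1 - 1 / (2 * a) := by
  have h1 : 0 < a - 1 := by linarith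
  have h3 : 0 < a := by linarith
  have := log_le_half_sub_inv (t := a / (a - 1)) (by rw [le_div_iff₀ h1]; linarith)
  calc _ ≤ (a - 1) * ((a / (a - 1) - (a / (a - 1))⁻¹) / 2) := mul_le_mul_of_nonneg_left this h1.le
    _ = _ := by field_simp; ring

theorem two_div_le_log {n : ℝ} (hn : 1 < n) : 2 / (2 * n - 1) ≤ log (n / (n - 1)) := by
  have h1 : 0 < n - 1 := by linarith
  have h := le_log_one_add_of_nonneg (x := 1 / (n - 1)) (by positivity)
  have e1 : 1 + 1 / (n - 1) = n / (n - 1) := by field_simp; ring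
  have e2 : 2 * (1 / (n - 1)) / (1 / (n - 1) + 2) = 2 / (2 * n - 1) := by
    have : 2 * n - 1 ≠ 0 := by linarith
    field_simp
    ring
  rwa [e1, e2] at h

theorem sliceLog_recursion_one {b : ℕ} (hb : 1 ≤ b) :
    ((b : ℝ) - 1) * sliceLog 1 (b - 1) ≤ (b : ℝ) * (1 - 1 / (1 + b)) * sliceLog 1 b := by
  rcases hb.eq_or_lt with rfl | hb
  · have := sliceLog_nonneg (a := 1) (b := 1) (by simp) (by simp)
    norm_num
    linarith
  · have hb : (2 : ℝ) ≤ b := by exact_mod_cast hb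
    have hw := sliceLog_nonneg (a := 1) (b := b) (by simp) (by linarith)
    have h := sub_one_mul_log_le (a := b) (by linarith)
    have hl := two_div_le_log (n := b + 1) (by linarith)
    rw [sliceLog_comm 1, sliceLog_sub_one (by linarith) one_pos, sliceLog_comm _ 1]
    have h5 : 1 - 1 / (2 * (b : ℝ)) ≤ 2 * (b - 1) * (2 / (2 * (b + 1) - 1)) := by
      rw [← sub_nonneg]
      have : 2 * ((b : ℝ) - 1) * (2 / (2 * (b + 1) - 1)) - (1 - 1 / (2 * (b : ℝ)))
        = (4 * (b : ℝ) ^ 2 - 8 * b + 1) / ((2 * b + 1) * (2 * b)) := by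
        have : 2 * ((b : ℝ) + 1) - 1 ≠ 0 := by linarith
        have : 2 * (b : ℝ) + 1 ≠ 0 := by linarith
        field_simp
        ring
      rw [this]
      refine div_nonneg ?_ (by positivity)
      nlinarith
    have h6 := mul_le_mul_of_nonneg_left hl (show 0 ≤ 2 * ((b : ℝ) - 1) by linarith)
    have h7 : (b : ℝ) * (1 - 1 / (1 + b)) * sliceLog 1 b
        = (b - 1) * sliceLog 1 b + sliceLog 1 b / (1 + b) := by
      field_simp; ring
    rw [h7]
    have : 0 ≤ sliceLog 1 (b : ℝ) / (1 + b) := by positivity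
    nlinarith

theorem sliceLog_recursion {a b : ℕ} (ha : 1 ≤ a) (hb : 1 ≤ b) :
    ((a : ℝ) - 1) * sliceLog (a - 1) b + ((b : ℝ) - 1) * sliceLog a (b - 1)
      ≤ ((a : ℝ) + b - 1) * (1 - 1 / (a + b)) * sliceLog a b := by
  rcases ha.eq_or_lt with rfl | ha
  · simpa using sliceLog_recursion_one hb
  rcases hb.eq_or_lt with rfl | hb
  · have := sliceLog_recursion_one ha.le
    rw [sliceLog_comm ((a : ℝ) - 1), sliceLog_comm (a : ℝ) (1 : ℕ)]
    simpa [add_comm] using this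
  have ha' : (2 : ℝ) ≤ a := by exact_mod_cast ha
  have hb' : (2 : ℝ) ≤ b := by exact_mod_cast hb
  have hw := log_four_le_sliceLog (a := a) (b := b) (by linarith) (by linarith)
  have hlog2 := log_two_gt_d9
  rw [sliceLog_comm _ ((b : ℝ) - 1), sliceLog_sub_one (by linarith) (by linarith),
    sliceLog_sub_one (by linarith) (by linarith), sliceLog_comm b a, add_comm (b : ℝ) a]
  set w := sliceLog (a : ℝ) b
  set l := log (((a : ℝ) + b) / (a + b - 1))
  have hsplit : ((a : ℝ) + b - 1) * (1 - 1 / (a + b)) * w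
      = (a - 1) * w + (b - 1) * w + w / (a + b) := by
    field_simp; ring
  rw [hsplit]
  suffices (a - 1) * log ((a : ℝ) / (a - 1)) + (b - 1) * log ((b : ℝ) / (b - 1))
      ≤ w / (a + b) + 2 * (a + b - 2) * l by nlinarith
  by_cases h4 : a = 2 ∧ b = 2
  · obtain ⟨rfl, rfl⟩ := h4
    have hl : l = 2 * log 2 - log 3 := by
      simp only [l]
      rw [show ((2 : ℕ) + (2 : ℕ) : ℝ) / ((2 : ℕ) + (2 : ℕ) - 1) = 2 ^ 2 / 3 by norm_num,
        log_div (by norm_num) (by norm_num), log_pow]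
      push_cast; ring
    have h3 : 8 * log 3 ≤ 13 * log 2 := by
      have : log ((3 : ℝ) ^ 8) ≤ log (2 ^ 13) := log_le_log (by norm_num) (by norm_num)
      rw [log_pow, log_pow] at this
      exact_mod_cast this
    rw [hl]
    norm_num
    linarith
  · have h5 : (5 : ℝ) ≤ a + b := by
      have : 5 ≤ a + b := by omega
      exact_mod_cast this
    have h1 := sub_one_mul_log_le (a := a) (by linarith)
    have h2 := sub_one_mul_log_le (a := b) (by linarith)
    have hl := two_div_le_log (n := a + b) (by linarith)
    have h6 := mul_le_mul_of_nonneg_left hl (show 0 ≤ 2 * ((a : ℝ) + b - 2) by linarith)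
    have h7 : 2 / ((a : ℝ) + b) ≤ 1 / (2 * a) + 1 / (2 * b) := by
      rw [div_add_div _ _ (by positivity) (by positivity),
        div_le_div_iff₀ (by positivity) (by positivity)]
      nlinarith [sq_nonneg ((a : ℝ) - b)]
    have h8 : (69 / 50) / ((a : ℝ) + b) ≤ w / (a + b) := by
      gcongr
      linarith
    have h9 : 2 - 2 / ((a : ℝ) + b)
        ≤ (69 / 50) / (a + b) + 2 * (a + b - 2) * (2 / (2 * (a + b) - 1)) := by
      generalize (a : ℝ) + b = n at h5
      have hn : 0 < 2 * n - 1 := by linarith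
      have hn0 : 0 < n := by linarith
      have hn1 := hn.ne'
      rw [← sub_nonneg]
      have : (69 / 50) / n + 2 * (n - 2) * (2 / (2 * n - 1)) - (2 - 2 / n)
        = (19 / 25 * n - 169 / 50) / (n * (2 * n - 1)) := by
        rw [eq_div_iff (by positivity)]
        have e1 : 2 / (2 * n - 1) * (2 * n - 1) = 2 := div_mul_cancel₀ _ hn1
        have e2 : 2 / n * n = 2 := div_mul_cancel₀ _ hn0.ne'
        have e3 : 69 / 50 / n * n = 69 / 50 := div_mul_cancel₀ _ hn0.ne'
        linear_combination (2 * n - 1) * e3 + 2 * (n - 2) * n * e1 + (2 * n - 1) * e2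
      rw [this]
      exact div_nonneg (by linarith) (by positivity)
    linarith

theorem entropy_bound_of_le_half {q : ℝ} (hq : 0 < q) (hq2 : q ≤ 1 / 2) :
    (1 - q) * (-log q - log (1 - q)) + 2 * q - 1 ≤ -log q := by
  let ψ : ℝ → ℝ := fun q => q * log q - (1 - q) * log (1 - q) + 2 * q - 1
  have hcont : Continuous ψ := by
    have := continuous_mul_log.comp (by fun_prop : Continuous fun q : ℝ => 1 - q)
    exact ((continuous_mul_log.sub this).add (by fun_prop)).sub continuous_const
  have hderiv : ∀ y ∈ Set.Ioo (0 : ℝ) (1 / 2), HasDerivAt ψ (log (y * (1 - y)) + 4) y := by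
    intro y hy
    have h0 : y ≠ 0 := hy.1.ne'
    have h1 : 1 - y ≠ 0 := by linarith [hy.2]
    have hs : HasDerivAt (fun q : ℝ => 1 - q) (-1) y := by
      simpa using (hasDerivAt_id y).const_sub 1
    have h := (((hasDerivAt_mul_log h0).sub ((hasDerivAt_mul_log h1).comp y hs)).add
      ((hasDerivAt_id y).const_mul 2)).sub_const 1
    refine h.congr_deriv ?_
    rw [log_mul h0 h1]
    ring
  have hconv : ConvexOn ℝ (Set.Icc 0 (1 / 2)) ψ := by
    refine MonotoneOn.convexOn_of_deriv (convex_Icc _ _) hcont.continuousOn ?_ ?_ <;>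
      rw [interior_Icc]
    · exact fun y hy => (hderiv y hy).differentiableAt.differentiableWithinAt
    · intro y hy z hz hyz
      rw [(hderiv y hy).deriv, (hderiv z hz).deriv]
      have := hy.2
      have := hz.2
      have := log_le_log (mul_pos hy.1 (by linarith : 0 < 1 - y))
        (show y * (1 - y) ≤ z * (1 - z) by nlinarith)
      linarith
  have h := hconv.le_max_of_mem_Icc (x := 0) (y := 1 / 2) (by norm_num) (by norm_num) ⟨hq.le, hq2⟩
  have e0 : ψ 0 = -1 := by simp [ψ]
  have e1 : ψ (1 / 2) = 0 := by simp only [ψ]; norm_num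
  rw [e0, e1] at h
  norm_num at h
  simp only [ψ] at h
  linarith

theorem entropy_bound_of_half_le {q : ℝ} (hq : 1 / 2 ≤ q) (hq1 : q < 1) :
    (1 - q) * (-log q - log (1 - q)) + 2 * q - 1 ≤ -log (1 - q) := by
  let D : ℝ → ℝ := fun q => 2 * q - 1 + (1 - q) * (-log q) + q * log (1 - q)
  have hderiv : ∀ y, 1 / 2 ≤ y → y < 1 → HasDerivAt D
      (2 + log y + log (1 - y) - (1 - y) / y - y / (1 - y)) y := by
    intro y hy hy1
    have h0 : y ≠ 0 := by linarith
    have h1 : 1 - y ≠ 0 := by linarith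
    have hs : HasDerivAt (fun q : ℝ => 1 - q) (-1) y := by
      simpa using (hasDerivAt_id y).const_sub 1
    have h := ((((hasDerivAt_id y).const_mul 2).sub_const 1).add
      (hs.mul (hasDerivAt_log h0).neg)).add ((hasDerivAt_id y).mul (hs.log h1))
    refine h.congr_deriv ?_
    simp only [id, Pi.neg_apply]
    field_simp
    ring
  have hanti : AntitoneOn D (Set.Ico (1 / 2) 1) := by
    refine antitoneOn_of_deriv_nonpos (convex_Ico _ _)
      (fun y hy => (hderiv y hy.1 hy.2).continuousAt.continuousWithinAt) ?_ ?_ <;>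
      rw [interior_Ico]
    · exact fun y hy => (hderiv y hy.1.le hy.2).differentiableAt.differentiableWithinAt
    · intro y hy
      rw [(hderiv y hy.1.le hy.2).deriv]
      have h0 : 0 < y := by linarith [hy.1]
      have h1 : 0 < 1 - y := by linarith [hy.2]
      have hl0 := log_nonpos h0.le hy.2.le
      have hl1 := log_nonpos h1.le (by linarith)
      have : 2 ≤ (1 - y) / y + y / (1 - y) := by
        rw [div_add_div _ _ h0.ne' h1.ne', le_div_iff₀ (by positivity)]
        nlinarith [sq_nonneg (1 - 2 * y)]
      linarith
  have h := hanti ⟨le_rfl, by norm_num⟩ ⟨hq, hq1⟩ hq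
  have e : D (1 / 2) = 0 := by
    simp only [D]; norm_num
  rw [e] at h
  simp only [D] at h
  linarith

theorem entropy_bound_pair {q r μ : ℝ} (hq : 0 < q) (hr : 0 < r) (hqr : q + r ≤ 1) (hμ : 0 < μ)
    (hμq : μ ≤ q) (hμr : μ ≤ r) :
    (1 - q) * (-log q - log (1 - q)) + (1 - r) * (-log r - log (1 - r)) + 2 * (q + r - 1)
      ≤ -(2 * log μ) := by
  wlog hle : r ≤ q generalizing q r
  · linarith [this hr hq (by linarith) hμr hμq (by linarith)]
  have h1 := entropy_bound_of_le_half hr (by linarith)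
  have h2 := log_le_log hμ hμr
  have h3 := log_le_log hμ hμq
  have h4 := log_le_log hμ (show μ ≤ 1 - q by linarith)
  rcases le_total q (1 / 2) with h | h
  · linarith [entropy_bound_of_le_half hq h]
  · linarith [entropy_bound_of_half_le h (by linarith)]

theorem sum_log_merge_le {α : Type*} [DecidableEq α] {K : Finset α} {κ : α → ℝ}
    {N m : ℝ} (hm : 0 < m)
    (hκ : ∀ k ∈ K, m ≤ κ k) (hN : ∑ k ∈ K, κ k = N) {u v : α} (hu : u ∈ K) (hv : v ∈ K)
    (huv : u ≠ v) :
    ∑ k ∈ (K.erase u).erase v, 2 * log ((N - κ k) / m)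
      + (N - κ u) * sliceLog (κ u) (N - κ u) / N + (N - κ v) * sliceLog (κ v) (N - κ v) / N
      ≤ ((K.card : ℝ) - 1) * (2 * log (N / m)) := by
  have hv' : v ∈ K.erase u := mem_erase.2 ⟨huv.symm, hv⟩
  have hpos : ∀ k ∈ K, 0 < κ k := fun k hk => hm.trans_le (hκ k hk)
  have hsum : ∑ k ∈ (K.erase u).erase v, κ k = N - κ u - κ v := by
    rw [← hN, ← add_sum_erase K κ hu, ← add_sum_erase _ κ hv']
    ring
  have hrest : 0 ≤ N - κ u - κ v := by
    rw [← hsum]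
    exact sum_nonneg fun k hk => (hpos k (mem_of_mem_erase (mem_of_mem_erase hk))).le
  have hu0 := hpos u hu
  have hv0 := hpos v hv
  have hN0 : 0 < N := by linarith
  have hcard : (((K.erase u).erase v).card : ℝ) = K.card - 2 := by
    have h1 := card_erase_add_one hu
    have h2 := card_erase_add_one hv'
    have : ((K.erase u).erase v).card + 2 = K.card := by omega
    rw [← this]; push_cast; ring
  have hlogs : ∑ k ∈ (K.erase u).erase v, 2 * log ((N - κ k) / m)
      ≤ (K.card - 2) * (2 * log (N / m)) - 2 * ((N - κ u - κ v) / N) := by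
    rw [← hcard, ← hsum, sum_div, mul_sum, ← nsmul_eq_mul, ← sum_const, ← sum_sub_distrib]
    refine sum_le_sum fun k hk => ?_
    have hku := ne_of_mem_erase (mem_of_mem_erase hk)
    have hkK := mem_of_mem_erase (mem_of_mem_erase hk)
    have hklt : κ k < N := by
      have : κ k ≤ ∑ k ∈ (K.erase u).erase v, κ k := single_le_sum
        (fun k hk => (hpos k (mem_of_mem_erase (mem_of_mem_erase hk))).le) hk
      linarith
    have h0 : 0 < N - κ k := by linarith
    have := log_le_sub_one_of_pos (div_pos h0 hN0)
    rw [log_div h0.ne' hN0.ne', sub_div, div_self hN0.ne'] at this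
    rw [log_div h0.ne' hm.ne', log_div hN0.ne' hm.ne']
    linarith
  have hslice : ∀ k : α, 0 < κ k → κ k < N → (N - κ k) * sliceLog (κ k) (N - κ k) / N
      = (1 - κ k / N) * (-log (κ k / N) - log (1 - κ k / N)) := by
    intro k hk hkN
    have h0 : 0 < N - κ k := by linarith
    rw [show 1 - κ k / N = (N - κ k) / N by field_simp, sliceLog, add_sub_cancel,
      log_div (by positivity) (by positivity), log_mul hk.ne' h0.ne', log_pow,
      log_div hk.ne' hN0.ne', log_div h0.ne' hN0.ne']
    push_cast
    field_simp
    ring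
  rw [hslice u hu0 (by linarith), hslice v hv0 (by linarith)]
  have hpair := entropy_bound_pair (q := κ u / N) (r := κ v / N) (μ := m / N) (by positivity)
    (by positivity) (by rw [← add_div, div_le_one hN0]; linarith) (by positivity)
    (by gcongr; exact hκ u hu) (by gcongr; exact hκ v hv)
  have hμ : log (m / N) = -log (N / m) := by rw [← log_inv, inv_div]
  have hfrac : (N - κ u - κ v) / N = 1 - κ u / N - κ v / N := by field_simp
  rw [hμ] at hpair
  rw [hfrac] at hlogs
  linarith
section Entropy

variable {X Y : Type*}

/-- Unnormalised entropy of `g` with respect to the counting measure on `Ω`. -/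
def entSum (Ω : Finset X) (g : X → ℝ) : ℝ :=
  ∑ ω ∈ Ω, g ω * log (g ω) - (∑ ω ∈ Ω, g ω) * log ((∑ ω ∈ Ω, g ω) / #Ω)

theorem entSum_empty (g : X → ℝ) : entSum ∅ g = 0 := by simp [entSum]

theorem entSum_singleton (ω : X) (g : X → ℝ) : entSum {ω} g = 0 := by simp [entSum]

theorem card_mul_uent (Ω : Finset X) (hΩ : Ω.Nonempty) (g : X → ℝ) :
    #Ω * uent Ω g = entSum Ω g := by
  have : (#Ω : ℝ) ≠ 0 := by exact_mod_cast hΩ.card_pos.ne'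
  simp only [uent, uexpect, entSum]
  field_simp

theorem entSum_image [DecidableEq Y] (Ω : Finset X) (e : X → Y) (he : Function.Injective e)
    (g : Y → ℝ) : entSum (Ω.image e) g = entSum Ω (g ∘ e) := by
  simp only [entSum, sum_image he.injOn, card_image_of_injective _ he, Function.comp]

/-- Chain rule for the entropy. -/
theorem entSum_fiberwise [DecidableEq Y] {Ω : Finset X} {T : Finset Y} {φ : X → Y}
    (hφ : ∀ ω ∈ Ω, φ ω ∈ T) (g : X → ℝ) :
    entSum Ω g = ∑ b ∈ T, entSum {ω ∈ Ω | φ ω = b} g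
      + (∑ b ∈ T, (∑ ω ∈ Ω with φ ω = b, g ω)
            * log ((∑ ω ∈ Ω with φ ω = b, g ω) / #{ω ∈ Ω | φ ω = b})
          - (∑ ω ∈ Ω, g ω) * log ((∑ ω ∈ Ω, g ω) / #Ω)) := by
  simp only [entSum, sum_sub_distrib]
  rw [sum_fiberwise_of_maps_to hφ]
  ring

theorem sq_sqrt_sum_sub_sqrt_sum_le (P : Finset X) (a b : X → ℝ) :
    (√(∑ p ∈ P, a p ^ 2) - √(∑ p ∈ P, b p ^ 2)) ^ 2 ≤ ∑ p ∈ P, (a p - b p) ^ 2 := by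
  have ha : 0 ≤ ∑ p ∈ P, a p ^ 2 := sum_nonneg fun _ _ => sq_nonneg _
  have hb : 0 ≤ ∑ p ∈ P, b p ^ 2 := sum_nonneg fun _ _ => sq_nonneg _
  have hab : ∑ p ∈ P, a p * b p ≤ √(∑ p ∈ P, a p ^ 2) * √(∑ p ∈ P, b p ^ 2) := by
    rw [← sqrt_mul ha]
    exact (le_abs_self _).trans (abs_le_sqrt (sum_mul_sq_le_sq_mul_sq _ _ _))
  have h : ∑ p ∈ P, (a p - b p) ^ 2
      = ∑ p ∈ P, a p ^ 2 + ∑ p ∈ P, b p ^ 2 - 2 * ∑ p ∈ P, a p * b p := by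
    rw [mul_sum, ← sum_add_distrib, ← sum_sub_distrib]
    exact sum_congr rfl fun _ _ => by ring
  rw [h, sub_sq, sq_sqrt ha, sq_sqrt hb]
  linarith

end Entropy

section Slice

variable {ι α : Type*} [Fintype ι] [DecidableEq ι] [Fintype α] [DecidableEq α]

/-- The colourings of `ι` obtained from `ω₀` by rearranging the colours on `S`. -/
def colorSlice (S : Finset ι) (ω₀ : ι → α) : Finset (ι → α) :=
  {ω | (∀ i ∉ S, ω i = ω₀ i) ∧ ∀ c, #{i | ω i = c} = #{i | ω₀ i = c}}

/-- The number of sites in `S` with colour `c`. -/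
def colorCount {ι α : Type*} [DecidableEq α] (S : Finset ι) (ω : ι → α) (c : α) : ℕ :=
  #{i ∈ S | ω i = c}

/-- Squared increment of `f` under the exchange of the sites `i` and `j`. -/
def sqDiff {ι α : Type*} [DecidableEq ι] (f : (ι → α) → ℝ) (i j : ι) (ω : ι → α) : ℝ :=
  (f ω - f (ω ∘ Equiv.swap i j)) ^ 2

theorem sqDiff_nonneg {ι α : Type*} [DecidableEq ι] (f : (ι → α) → ℝ) (i j : ι) (ω : ι → α) :
    0 ≤ sqDiff f i j ω := sq_nonneg _

theorem sqDiff_comm {ι α : Type*} [DecidableEq ι] (f : (ι → α) → ℝ) (i j : ι) (ω : ι → α) :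
    sqDiff f i j ω = sqDiff f j i ω := by
  rw [sqDiff, sqDiff, Equiv.swap_comm]

theorem comp_swap_eq_self {ι α : Type*} [DecidableEq ι] {ω : ι → α} {i j : ι} (h : ω i = ω j) :
    ω ∘ Equiv.swap i j = ω := by
  funext k
  simp only [Function.comp]
  rcases eq_or_ne k i with rfl | hi
  · rw [Equiv.swap_apply_left, h]
  rcases eq_or_ne k j with rfl | hj
  · rw [Equiv.swap_apply_right, h]
  rw [Equiv.swap_apply_of_ne_of_ne hi hj]

theorem sqDiff_eq_zero {ι α : Type*} [DecidableEq ι] {f : (ι → α) → ℝ} {ω : ι → α} {i j : ι}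
    (h : ω i = ω j) : sqDiff f i j ω = 0 := by
  rw [sqDiff, comp_swap_eq_self h, sub_self, zero_pow two_ne_zero]

theorem comp_swap_comp_swap {ι α : Type*} [DecidableEq ι] (ω : ι → α) (i j : ι) :
    (ω ∘ Equiv.swap i j) ∘ Equiv.swap i j = ω := by
  funext k
  simp

theorem mem_colorSlice {S : Finset ι} {ω₀ ω : ι → α} :
    ω ∈ colorSlice S ω₀ ↔ (∀ i ∉ S, ω i = ω₀ i) ∧ ∀ c, #{i | ω i = c} = #{i | ω₀ i = c} := by
  simp [colorSlice]

theorem self_mem_colorSlice (S : Finset ι) (ω₀ : ι → α) : ω₀ ∈ colorSlice S ω₀ := by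
  simp [mem_colorSlice]

theorem colorCount_eq_of_mem_colorSlice {S : Finset ι} {ω₀ ω : ι → α}
    (h : ω ∈ colorSlice S ω₀) (c : α) :
    colorCount S ω c = colorCount S ω₀ c := by
  rw [mem_colorSlice] at h
  have hsplit : ∀ η : ι → α, #{i | η i = c} = colorCount S η c + colorCount Sᶜ η c := by
    intro η
    rw [colorCount, colorCount, ← card_union_of_disjoint
      (disjoint_filter_filter disjoint_compl_right), ← filter_union, union_compl]
  have hoff : colorCount Sᶜ ω c = colorCount Sᶜ ω₀ c := by
    rw [colorCount, colorCount]
    congr 1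
    exact filter_congr fun i hi => by rw [h.1 i (mem_compl.1 hi)]
  have := h.2 c
  rw [hsplit, hsplit, hoff] at this
  omega

theorem card_filter_comp_perm {ι α : Type*} [Fintype ι] [DecidableEq α] (ω : ι → α)
    (σ : Equiv.Perm ι) (c : α) :
    #{i | (ω ∘ σ) i = c} = #{i | ω i = c} := by
  refine card_bij (fun i _ => σ i) (fun i hi => by simpa using hi) (fun i _ j _ h => σ.injective h)
    fun j hj => ⟨σ.symm j, by simpa using hj, by simp⟩

theorem comp_perm_mem_colorSlice {S : Finset ι} {ω₀ ω : ι → α} (h : ω ∈ colorSlice S ω₀)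
    {σ : Equiv.Perm ι} (hσ : ∀ i ∉ S, σ i = i) : ω ∘ σ ∈ colorSlice S ω₀ := by
  rw [mem_colorSlice] at h ⊢
  refine ⟨fun i hi => ?_, fun c => ?_⟩
  · simp [hσ i hi, h.1 i hi]
  · rw [card_filter_comp_perm, h.2 c]

theorem comp_swap_mem_colorSlice {S : Finset ι} {ω₀ ω : ι → α} (h : ω ∈ colorSlice S ω₀) {i j : ι}
    (hi : i ∈ S) (hj : j ∈ S) : ω ∘ Equiv.swap i j ∈ colorSlice S ω₀ :=
  comp_perm_mem_colorSlice h fun _ hk => Equiv.swap_apply_of_ne_of_ne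
    (fun h => hk (h ▸ hi)) (fun h => hk (h ▸ hj))

theorem colorSlice_eq_singleton {S : Finset ι} {ω₀ : ι → α} (h : ∀ i ∈ S, ∀ j ∈ S, ω₀ i = ω₀ j) :
    colorSlice S ω₀ = {ω₀} := by
  refine eq_singleton_iff_unique_mem.2 ⟨self_mem_colorSlice S ω₀, fun ω hω => funext fun i => ?_⟩
  by_cases hi : i ∈ S
  · have hc := colorCount_eq_of_mem_colorSlice hω (ω i)
    have : 0 < colorCount S ω (ω i) := card_pos.2 ⟨i, by simp [hi]⟩
    rw [hc] at this
    obtain ⟨j, hj⟩ := card_pos.1 this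
    rw [mem_filter] at hj
    rw [← hj.2, h j hj.1 i hi]
  · exact (mem_colorSlice.1 hω).1 i hi

theorem filter_apply_eq_colorSlice_erase {S : Finset ι} {ω₀ ω : ι → α}
    (h : ω ∈ colorSlice S ω₀) (i : ι) :
    {ω' ∈ colorSlice S ω₀ | ω' i = ω i} = colorSlice (S.erase i) ω := by
  rw [mem_colorSlice] at h
  ext ω'
  rw [mem_filter, mem_colorSlice, mem_colorSlice]
  constructor
  · rintro ⟨⟨h1, h2⟩, h3⟩
    refine ⟨fun j hj => ?_, fun c => (h2 c).trans (h.2 c).symm⟩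
    rcases eq_or_ne j i with rfl | hji
    · exact h3
    · have hj : j ∉ S := fun hS => hj (mem_erase.2 ⟨hji, hS⟩)
      rw [h1 j hj, h.1 j hj]
  · rintro ⟨h1, h2⟩
    refine ⟨⟨fun j hj => ?_, fun c => (h2 c).trans (h.2 c)⟩, h1 i (notMem_erase i S)⟩
    rw [h1 j fun hS => hj (mem_of_mem_erase hS), h.1 j hj]

/-- The set of sites with colour `k`, as a two-coloured configuration. -/
def mark {ι α : Type*} [DecidableEq α] (k : α) (ω : ι → α) : ι → Bool := fun i => decide (ω i = k)

theorem mark_eq_true {ι α : Type*} [DecidableEq α] {k : α} {ω : ι → α} {i : ι} :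
    mark k ω i = true ↔ ω i = k := by simp [mark]

theorem mark_eq_false {ι α : Type*} [DecidableEq α] {k : α} {ω : ι → α} {i : ι} :
    mark k ω i = false ↔ ω i ≠ k := by simp [mark]

theorem filter_mark_eq_colorSlice {S : Finset ι} {ω₀ ω : ι → α} (h : ω ∈ colorSlice S ω₀) (k : α) :
    {ω' ∈ colorSlice S ω₀ | mark k ω' = mark k ω} = colorSlice {i ∈ S | ω i ≠ k} ω := by
  rw [mem_colorSlice] at h
  ext ω'
  rw [mem_filter, mem_colorSlice, mem_colorSlice]
  constructor
  · rintro ⟨⟨h1, h2⟩, h3⟩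
    refine ⟨fun j hj => ?_, fun c => (h2 c).trans (h.2 c).symm⟩
    rw [mem_filter, not_and, not_not] at hj
    by_cases hjS : j ∈ S
    · rw [hj hjS]
      rw [← mark_eq_true, h3, mark_eq_true, hj hjS]
    · rw [h1 j hjS, h.1 j hjS]
  · rintro ⟨h1, h2⟩
    refine ⟨⟨fun j hj => ?_, fun c => (h2 c).trans (h.2 c)⟩, ?_⟩
    · rw [h1 j fun hS => hj (mem_of_mem_filter _ hS), h.1 j hj]
    · have hsub : (univ.filter fun i => ω i = k) ⊆ univ.filter fun i => ω' i = k := by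
        intro i hi
        rw [mem_filter_univ] at hi ⊢
        rw [h1 i (by simp [hi]), hi]
      have heq := eq_of_subset_of_card_le hsub (h2 k).le
      funext i
      have := Finset.ext_iff.1 heq i
      rw [mem_filter_univ, mem_filter_univ] at this
      simp only [mark, this]

theorem mark_mem_colorSlice {S : Finset ι} {ω₀ ω : ι → α} (h : ω ∈ colorSlice S ω₀) (k : α) :
    mark k ω ∈ colorSlice S (mark k ω₀) := by
  rw [mem_colorSlice] at h ⊢
  refine ⟨fun i hi => by simp only [mark, h.1 i hi], fun c => ?_⟩
  cases c
  · simp only [mark_eq_false, ne_eq]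
    have h1 := card_filter_add_card_filter_not (s := (univ : Finset ι)) (fun i => ω i = k)
    have h2 := card_filter_add_card_filter_not (s := (univ : Finset ι)) (fun i => ω₀ i = k)
    have := h.2 k
    omega
  · simpa only [mark_eq_true] using h.2 k

theorem mark_comp_swap {ι α : Type*} [DecidableEq ι] [DecidableEq α] (k : α) (ω : ι → α) (i j : ι) :
    mark k (ω ∘ Equiv.swap i j) = mark k ω ∘ Equiv.swap i j := rfl

theorem exists_perm_of_mem_colorSlice {S : Finset ι} {ω ω' : ι → α} (h : ω' ∈ colorSlice S ω) :
    ∃ σ : Equiv.Perm ι, (∀ i ∉ S, σ i = i) ∧ ω ∘ σ = ω' := by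
  let u : (ι → α) → ι → α ⊕ ι := fun η i => if i ∈ S then Sum.inl (η i) else Sum.inr i
  have hcard : ∀ y, Nonempty ({i // u ω' i = y} ≃ {i // u ω i = y}) := by
    intro y
    rw [← Fintype.card_eq, Fintype.card_subtype, Fintype.card_subtype]
    rcases y with c | j
    · have hu : ∀ η : ι → α, #{i | u η i = Sum.inl c} = colorCount S η c := by
        intro η
        rw [colorCount]
        congr 1
        ext i
        by_cases hi : i ∈ S <;> simp [u, hi]
      rw [hu, hu, colorCount_eq_of_mem_colorSlice h]
    · congr 1
      ext i
      by_cases hi : i ∈ S <;> simp [u, hi]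
  let σ : Equiv.Perm ι := Equiv.ofFiberEquiv fun y => (hcard y).some
  have hσ : ∀ i, u ω (σ i) = u ω' i := Equiv.ofFiberEquiv_map _
  have hfix : ∀ i ∉ S, σ i = i := by
    intro i hi
    have := hσ i
    by_cases h' : σ i ∈ S <;> simp [u, hi, h'] at this
    exact this
  refine ⟨σ, hfix, funext fun i => ?_⟩
  by_cases hi : i ∈ S
  · have := hσ i
    by_cases h' : σ i ∈ S <;> simp [u, hi, h'] at this
    exact this
  · rw [Function.comp, hfix i hi, (mem_colorSlice.1 h).1 i hi]

theorem mem_colorSlice_comm {S : Finset ι} {ω ω' : ι → α} :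
    ω' ∈ colorSlice S ω ↔ ω ∈ colorSlice S ω' := by
  simp only [mem_colorSlice, eq_comm]

theorem card_mark_fiber_eq {S : Finset ι} {ω₀ : ι → α} {k : α} {η : ι → Bool}
    (hη : η ∈ colorSlice S (mark k ω₀)) :
    #{ω ∈ colorSlice S ω₀ | mark k ω = η} = #{ω ∈ colorSlice S ω₀ | mark k ω = mark k ω₀} := by
  have key : ∀ η η' : ι → Bool, η' ∈ colorSlice S η →
      #{ω ∈ colorSlice S ω₀ | mark k ω = η} ≤ #{ω ∈ colorSlice S ω₀ | mark k ω = η'} := by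
    intro η η' h
    obtain ⟨σ, hσ, rfl⟩ := exists_perm_of_mem_colorSlice h
    refine card_le_card_of_injOn (fun ω => ω ∘ σ) (fun ω hω => ?_) fun ω _ ω' _ h => ?_
    · simp only [coe_filter, Set.mem_ofPred_eq] at hω ⊢
      refine ⟨comp_perm_mem_colorSlice hω.1 hσ, ?_⟩
      rw [← hω.2]
      rfl
    · exact σ.surjective.injective_comp_right h
  exact le_antisymm (key _ _ (mem_colorSlice_comm.1 hη)) (key _ _ hη)

end Slice
section TwoColours

theorem binary_entropy_le {a b n₁ n₀ F₁ F₀ E : ℝ} (ha : 0 < a) (hb : 0 < b) (hn₁ : 0 < n₁)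
    (hn₀ : 0 < n₀) (hF₁ : 0 ≤ F₁) (hF₀ : 0 ≤ F₀) (hn : b * n₁ = a * n₀)
    (hE : (√(b * F₁) - √(a * F₀)) ^ 2 ≤ E) :
    F₁ * log (F₁ / n₁) + F₀ * log (F₀ / n₀) - (F₁ + F₀) * log ((F₁ + F₀) / (n₁ + n₀))
      ≤ sliceLog a b / (log 2 * (a + b)) * E := by
  have hab : 0 < a + b := add_pos ha hb
  have hab' := hab.ne'
  have h₁ : n₁ = a / (a + b) * (n₁ + n₀) := by
    field_simp
    linarith
  have h₀ : n₀ = b / (a + b) * (n₁ + n₀) := by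
    field_simp
    linarith
  have hnn : 0 < n₁ + n₀ := add_pos hn₁ hn₀
  have key := two_point_logSobolev (p := a / (a + b)) (q := b / (a + b)) (x := √(F₁ / n₁))
    (y := √(F₀ / n₀)) (by positivity) (by positivity) (by field_simp) (sqrt_nonneg _)
    (sqrt_nonneg _)
  have hlog : log (1 / (a / (a + b) * (b / (a + b)))) = sliceLog a b := by
    rw [sliceLog]
    congr 1
    field_simp
  rw [hlog, sq_sqrt (div_nonneg hF₁ hn₁.le), sq_sqrt (div_nonneg hF₀ hn₀.le)] at key
  have e₁ : a / (a + b) * (F₁ / n₁) * (n₁ + n₀) = F₁ := by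
    rw [mul_right_comm, ← h₁]
    field_simp
  have e₀ : b / (a + b) * (F₀ / n₀) * (n₁ + n₀) = F₀ := by
    rw [mul_right_comm, ← h₀]
    field_simp
  have e : a / (a + b) * (F₁ / n₁) + b / (a + b) * (F₀ / n₀) = (F₁ + F₀) / (n₁ + n₀) := by
    rw [eq_div_iff hnn.ne', add_mul, e₁, e₀]
  have hsq : (n₁ + n₀) * (a / (a + b) * (b / (a + b)) * (√(F₁ / n₁) - √(F₀ / n₀)) ^ 2)
      = (√(b * F₁) - √(a * F₀)) ^ 2 / (a + b) := by
    have r₁ : √(b * F₁) = √(b * n₁) * √(F₁ / n₁) := by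
      rw [← sqrt_mul (by positivity)]
      congr 1
      field_simp
    have r₀ : √(a * F₀) = √(b * n₁) * √(F₀ / n₀) := by
      rw [hn, ← sqrt_mul (by positivity)]
      congr 1
      field_simp
    rw [r₁, r₀, ← mul_sub, mul_pow, sq_sqrt (by positivity)]
    calc _ = (a / (a + b) * (n₁ + n₀)) * (b / (a + b)) * (√(F₁ / n₁) - √(F₀ / n₀)) ^ 2 := by ring
      _ = _ := by rw [← h₁]; ring
  have hlog2 : 0 < log 2 := log_pos one_lt_two
  have hw := sliceLog_nonneg ha.le hb.le
  rw [e] at key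
  have key' := mul_le_mul_of_nonneg_left key hnn.le
  calc _ = (n₁ + n₀) * (a / (a + b) * (F₁ / n₁ * log (F₁ / n₁))
        + b / (a + b) * (F₀ / n₀ * log (F₀ / n₀))
        - (F₁ + F₀) / (n₁ + n₀) * log ((F₁ + F₀) / (n₁ + n₀))) := by
        have e₂ : (n₁ + n₀) * ((F₁ + F₀) / (n₁ + n₀)) = F₁ + F₀ := by field_simp
        linear_combination -(log (F₁ / n₁)) * e₁ - log (F₀ / n₀) * e₀
          + log ((F₁ + F₀) / (n₁ + n₀)) * e₂
    _ ≤ _ := key'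
    _ = sliceLog a b / (log 2 * (a + b)) * (√(b * F₁) - √(a * F₀)) ^ 2 := by
        rw [mul_left_comm, hsq]
        field_simp
    _ ≤ _ := mul_le_mul_of_nonneg_left hE (by positivity)

variable {ι : Type*} [Fintype ι] [DecidableEq ι]

theorem sum_mul_sum_erase {ι : Type*} [DecidableEq ι] {S : Finset ι} (v : ι → ℝ) (g : ι → ι → ℝ) :
    ∑ i ∈ S, v i * ∑ j ∈ S.erase i, ∑ k ∈ S.erase i, g j k
      = ∑ j ∈ S, ∑ k ∈ S, g j k * ∑ i ∈ (S.erase j).erase k, v i := by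
  simp_rw [mul_sum]
  rw [sum_comm' (t' := S) (s' := fun j => S.erase j)
    fun i j => by simp only [mem_erase]; tauto]
  refine sum_congr rfl fun j _ => ?_
  rw [sum_comm' (t' := S) (s' := fun k => (S.erase j).erase k)
    fun i k => by simp only [mem_erase]; tauto]
  exact sum_congr rfl fun k _ => sum_congr rfl fun i _ => mul_comm _ _

theorem colorCount_true_add_false {ι : Type*} (S : Finset ι) (ω : ι → Bool) :
    colorCount S ω true + colorCount S ω false = #S := by
  have := card_filter_add_card_filter_not (s := S) (fun i => ω i = true)
  simpa [colorCount] using this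

theorem sum_filter_swap {S : Finset ι} {ω₀ : ι → Bool} {i : ι} (hi : i ∈ S)
    (G : (ι → Bool) → ℝ) :
    ∑ ω ∈ colorSlice S ω₀ with ω i = true, ∑ j ∈ S with ω j = false, G (ω ∘ Equiv.swap i j)
      = ∑ ω ∈ colorSlice S ω₀ with ω i = false, ∑ j ∈ S with ω j = true, G ω := by
  rw [sum_sigma', sum_sigma']
  refine sum_nbij' (fun p => ⟨p.1 ∘ Equiv.swap i p.2, p.2⟩)
    (fun p => ⟨p.1 ∘ Equiv.swap i p.2, p.2⟩) ?_ ?_ ?_ ?_ ?_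
  · rintro ⟨ω, j⟩ h
    simp only [mem_sigma, mem_filter, Function.comp, Equiv.swap_apply_left,
      Equiv.swap_apply_right] at h ⊢
    exact ⟨⟨comp_swap_mem_colorSlice h.1.1 hi h.2.1, h.2.2⟩, h.2.1, h.1.2⟩
  · rintro ⟨ω, j⟩ h
    simp only [mem_sigma, mem_filter, Function.comp, Equiv.swap_apply_left,
      Equiv.swap_apply_right] at h ⊢
    exact ⟨⟨comp_swap_mem_colorSlice h.1.1 hi h.2.1, h.2.2⟩, h.2.1, h.1.2⟩
  · rintro ⟨ω, j⟩ _
    simp only [comp_swap_comp_swap]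
  · rintro ⟨ω, j⟩ _
    simp only [comp_swap_comp_swap]
  · rintro ⟨ω, j⟩ _
    rfl

theorem sum_filter_const {S : Finset ι} {ω₀ : ι → Bool} (i : ι) (c c' : Bool)
    (G : (ι → Bool) → ℝ) :
    ∑ ω ∈ colorSlice S ω₀ with ω i = c, ∑ j ∈ S with ω j = c', G ω
      = colorCount S ω₀ c' * ∑ ω ∈ colorSlice S ω₀ with ω i = c, G ω := by
  rw [mul_sum]
  refine sum_congr rfl fun ω hω => ?_
  rw [sum_const, nsmul_eq_mul, ← colorCount_eq_of_mem_colorSlice (mem_filter.1 hω).1 c',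
    colorCount]

theorem exists_mem_colorSlice_apply_eq {α : Type*} [Fintype α] [DecidableEq α] {S : Finset ι}
    {ω₀ : ι → α} {i : ι} (hi : i ∈ S) {c : α} (hc : 0 < colorCount S ω₀ c) :
    ∃ ω ∈ colorSlice S ω₀, ω i = c := by
  obtain ⟨j, hj⟩ := card_pos.1 hc
  rw [mem_filter] at hj
  exact ⟨ω₀ ∘ Equiv.swap i j, comp_swap_mem_colorSlice (self_mem_colorSlice _ _) hi hj.1, by
    simp [hj.2]⟩

theorem entropy_site_le {S : Finset ι} {ω₀ : ι → Bool} {i : ι} (hi : i ∈ S)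
    (ha : 0 < colorCount S ω₀ true) (hb : 0 < colorCount S ω₀ false) (f : (ι → Bool) → ℝ) :
    entSum (colorSlice S ω₀) (fun ω => f ω ^ 2)
      ≤ ∑ c, entSum {ω ∈ colorSlice S ω₀ | ω i = c} (fun ω => f ω ^ 2)
        + sliceLog (colorCount S ω₀ true) (colorCount S ω₀ false) / (log 2 * #S)
          * ∑ ω ∈ colorSlice S ω₀ with ω i = true, ∑ j ∈ S with ω j = false, sqDiff f i j ω := by
  have hsplit : ∀ g : (ι → Bool) → ℝ, ∑ ω ∈ colorSlice S ω₀, g ω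
      = ∑ ω ∈ colorSlice S ω₀ with ω i = true, g ω
        + ∑ ω ∈ colorSlice S ω₀ with ω i = false, g ω := by
    intro g
    rw [← sum_filter_add_sum_filter_not _ (fun ω => ω i = true)]
    simp
  have hcard := hsplit fun _ => 1
  have hM := sum_filter_swap (ω₀ := ω₀) hi fun _ => 1
  rw [sum_filter_const, sum_filter_const i false] at hM
  simp only [sum_const, nsmul_eq_mul, mul_one] at hcard hM
  have hpos : ∀ c, 0 < colorCount S ω₀ c → 0 < #{ω ∈ colorSlice S ω₀ | ω i = c} := by
    intro c hc
    obtain ⟨ω, hω, hωi⟩ := exists_mem_colorSlice_apply_eq hi hc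
    exact card_pos.2 ⟨ω, mem_filter.2 ⟨hω, hωi⟩⟩
  have hF₁ : (colorCount S ω₀ false : ℝ) * ∑ ω ∈ colorSlice S ω₀ with ω i = true, f ω ^ 2
      = ∑ p ∈ ({ω ∈ colorSlice S ω₀ | ω i = true}).sigma fun ω => {j ∈ S | ω j = false},
        f p.1 ^ 2 := by
    rw [← sum_filter_const, sum_sigma]
  have hF₀ : (colorCount S ω₀ true : ℝ) * ∑ ω ∈ colorSlice S ω₀ with ω i = false, f ω ^ 2
      = ∑ p ∈ ({ω ∈ colorSlice S ω₀ | ω i = true}).sigma fun ω => {j ∈ S | ω j = false},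
        f (p.1 ∘ Equiv.swap i p.2) ^ 2 := by
    rw [← sum_filter_const, ← sum_filter_swap hi fun ω => f ω ^ 2, sum_sigma]
  have hE := sq_sqrt_sum_sub_sqrt_sum_le
    (({ω ∈ colorSlice S ω₀ | ω i = true}).sigma fun ω => {j ∈ S | ω j = false})
    (fun p => f p.1) fun p => f (p.1 ∘ Equiv.swap i p.2)
  rw [← hF₁, ← hF₀, sum_sigma] at hE
  have key := binary_entropy_le (Nat.cast_pos.2 ha) (Nat.cast_pos.2 hb)
    (Nat.cast_pos.2 (hpos _ ha)) (Nat.cast_pos.2 (hpos _ hb))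
    (sum_nonneg fun ω _ => sq_nonneg (f ω)) (sum_nonneg fun ω _ => sq_nonneg (f ω)) hM hE
  rw [← hcard, ← hsplit, ← Nat.cast_add, colorCount_true_add_false] at key
  rw [entSum_fiberwise (T := univ) (φ := fun ω => ω i) fun _ _ => mem_univ _]
  simp only [Fintype.sum_bool]
  rw [add_le_add_iff_left]
  exact key

theorem colorCount_erase {ι α : Type*} [DecidableEq ι] [DecidableEq α] {S : Finset ι}
    {ω : ι → α} {i : ι}
    (hi : i ∈ S) (c : α) :
    (colorCount (S.erase i) ω c : ℝ) = colorCount S ω c - if ω i = c then 1 else 0 := by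
  simp only [colorCount, filter_erase]
  split_ifs with h
  · rw [cast_card_erase_of_mem (mem_filter.2 ⟨hi, h⟩)]
  · rw [erase_eq_of_notMem (s := {i ∈ S | ω i = c}) fun h' => h (mem_filter.1 h').2, sub_zero]

theorem sum_erase_erase_apply {ι : Type*} [DecidableEq ι] {S : Finset ι} {ω : ι → Bool}
    {j k : ι} (hj : j ∈ S) (hk : k ∈ S)
    (hjk : ω j ≠ ω k) (V : Bool → ℝ) :
    ∑ i ∈ (S.erase j).erase k, V (ω i)
      = (colorCount S ω true - 1) * V true + (colorCount S ω false - 1) * V false := by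
  have hk' : k ∈ S.erase j := mem_erase.2 ⟨fun h => hjk (h ▸ rfl), hk⟩
  have h₁ := add_sum_erase S (fun i => V (ω i)) hj
  have h₂ := add_sum_erase (S.erase j) (fun i => V (ω i)) hk'
  have h₃ : ∑ i ∈ S, V (ω i)
      = colorCount S ω true * V true + colorCount S ω false * V false := by
    rw [← sum_filter_add_sum_filter_not S (fun i => ω i = true), colorCount, colorCount,
      ← nsmul_eq_mul, ← nsmul_eq_mul]
    congr 1
    · exact sum_eq_card_nsmul fun i hi => by rw [(mem_filter.1 hi).2]
    · simp only [Bool.not_eq_true]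
      exact sum_eq_card_nsmul fun i hi => by rw [(mem_filter.1 hi).2]
  have h₄ : V (ω j) + V (ω k) = V true + V false := by
    cases hj : ω j <;> cases hk : ω k <;> simp_all [add_comm]
  linarith

theorem sum_filter_true_false_sqDiff (S : Finset ι) (ω₀ : ι → Bool) (f : (ι → Bool) → ℝ) :
    ∑ i ∈ S, ∑ ω ∈ colorSlice S ω₀ with ω i = true, ∑ j ∈ S with ω j = false, sqDiff f i j ω
      = (∑ ω ∈ colorSlice S ω₀, ∑ i ∈ S, ∑ j ∈ S, sqDiff f i j ω) / 2 := by
  simp only [sum_filter]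
  rw [sum_comm, sum_div]
  refine sum_congr rfl fun ω _ => ?_
  have h : ∑ i ∈ S, (if ω i = true then ∑ j ∈ S, if ω j = false then sqDiff f i j ω else 0 else 0)
      = ∑ i ∈ S, ∑ j ∈ S, if ω i = true ∧ ω j = false then sqDiff f i j ω else 0 := by
    refine sum_congr rfl fun i _ => ?_
    split_ifs with hi <;> simp [hi]
  rw [h, eq_div_iff two_ne_zero, mul_two]
  nth_rw 2 [sum_comm]
  simp only [← sum_add_distrib]
  refine sum_congr rfl fun i _ => sum_congr rfl fun j _ => ?_
  rw [sqDiff_comm f j i]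
  rcases eq_or_ne (ω i) (ω j) with hij | hij
  · simp [sqDiff_eq_zero hij]
  · cases hi : ω i <;> cases hj : ω j <;> simp_all

/-- Log-Sobolev inequality on a slice with two colours. -/
theorem entSum_colorSlice_bool_le (S : Finset ι) (ω₀ : ι → Bool) (f : (ι → Bool) → ℝ) :
    entSum (colorSlice S ω₀) (fun ω => f ω ^ 2)
      ≤ sliceLog (colorCount S ω₀ true) (colorCount S ω₀ false) / (log 2 * (2 * #S))
        * ∑ ω ∈ colorSlice S ω₀, ∑ i ∈ S, ∑ j ∈ S, sqDiff f i j ω := by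
  induction hS : #S generalizing S ω₀ with
  | zero =>
    rw [card_eq_zero.1 hS, colorSlice_eq_singleton (by simp), entSum_singleton]
    simp
  | succ n ih =>
  have hlog2 : 0 < log 2 := log_pos one_lt_two
  have hE : 0 ≤ ∑ ω ∈ colorSlice S ω₀, ∑ i ∈ S, ∑ j ∈ S, sqDiff f i j ω :=
    sum_nonneg fun _ _ => sum_nonneg fun _ _ => sum_nonneg fun _ _ => sqDiff_nonneg _ _ _ _
  have hw := sliceLog_nonneg (Nat.cast_nonneg (α := ℝ) (colorCount S ω₀ true))
    (Nat.cast_nonneg (α := ℝ) (colorCount S ω₀ false))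
  have hdeg : ∀ c, colorCount S ω₀ c = 0 → entSum (colorSlice S ω₀) (fun ω => f ω ^ 2)
      ≤ sliceLog (colorCount S ω₀ true) (colorCount S ω₀ false) / (log 2 * (2 * (n + 1 : ℕ)))
        * ∑ ω ∈ colorSlice S ω₀, ∑ i ∈ S, ∑ j ∈ S, sqDiff f i j ω := by
    intro c hc
    have hne : ∀ i ∈ S, ω₀ i = !c := by
      intro i hi
      have := filter_eq_empty_iff.1 (card_eq_zero.1 hc) hi
      cases c <;> simp_all
    rw [colorSlice_eq_singleton fun i hi j hj => by rw [hne i hi, hne j hj], entSum_singleton]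
    rw [colorSlice_eq_singleton fun i hi j hj => by rw [hne i hi, hne j hj]] at hE
    positivity
  rcases (colorCount S ω₀ true).eq_zero_or_pos with ha | ha
  · exact hdeg _ ha
  rcases (colorCount S ω₀ false).eq_zero_or_pos with hb | hb
  · exact hdeg _ hb
  have hab : colorCount S ω₀ true + colorCount S ω₀ false = n + 1 :=
    hS ▸ colorCount_true_add_false S ω₀
  have hn : 0 < n := by omega
  have habR : (colorCount S ω₀ true : ℝ) + colorCount S ω₀ false = n + 1 := by exact_mod_cast hab
  have hrec := sliceLog_recursion ha hb
  set a : ℝ := (colorCount S ω₀ true : ℝ) with ha'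
  set b : ℝ := (colorCount S ω₀ false : ℝ) with hb'
  set D := ∑ ω ∈ colorSlice S ω₀, ∑ i ∈ S, ∑ j ∈ S, sqDiff f i j ω with hD
  have hnR : (0 : ℝ) < n := Nat.cast_pos.2 hn
  let V : Bool → ℝ := fun c => bif c then sliceLog (a - 1) b else sliceLog a (b - 1)
  have hfiber : ∀ i ∈ S, ∀ c, entSum {ω ∈ colorSlice S ω₀ | ω i = c} (fun ω => f ω ^ 2)
      ≤ 1 / (log 2 * (2 * n)) * ∑ ω ∈ colorSlice S ω₀ with ω i = c,
        V (ω i) * ∑ j ∈ S.erase i, ∑ k ∈ S.erase i, sqDiff f j k ω := by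
    intro i hi c
    obtain ⟨ω, hω, rfl⟩ := exists_mem_colorSlice_apply_eq (ω₀ := ω₀) (c := c) hi
      (by cases c <;> assumption)
    have h := ih (S.erase i) ω (by rw [card_erase_of_mem hi, hS, Nat.add_sub_cancel])
    rw [colorCount_erase hi, colorCount_erase hi, colorCount_eq_of_mem_colorSlice hω,
      colorCount_eq_of_mem_colorSlice hω] at h
    have hV : sliceLog (a - if ω i = true then 1 else 0) (b - if ω i = false then 1 else 0)
        = V (ω i) := by
      cases ω i <;> simp [V]
    rw [← ha', ← hb', hV] at h
    rw [filter_apply_eq_colorSlice_erase hω]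
    refine h.trans_eq ?_
    rw [mul_sum, mul_sum]
    refine sum_congr rfl fun ω' hω' => ?_
    rw [(mem_colorSlice.1 hω').1 i (notMem_erase i S)]
    ring
  have hsite : ∀ i ∈ S, entSum (colorSlice S ω₀) (fun ω => f ω ^ 2)
      ≤ 1 / (log 2 * (2 * n)) * ∑ ω ∈ colorSlice S ω₀,
          V (ω i) * ∑ j ∈ S.erase i, ∑ k ∈ S.erase i, sqDiff f j k ω
        + sliceLog a b / (log 2 * (n + 1))
          * ∑ ω ∈ colorSlice S ω₀ with ω i = true, ∑ j ∈ S with ω j = false, sqDiff f i j ω := by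
    intro i hi
    refine (entropy_site_le hi ha hb f).trans ?_
    rw [hS, Nat.cast_succ, add_le_add_iff_right,
      ← sum_fiberwise_of_maps_to (s := colorSlice S ω₀) (t := univ) (g := fun ω => ω i)
        (fun _ _ => mem_univ _), mul_sum]
    exact sum_le_sum fun c _ => hfiber i hi c
  have hsum := sum_le_sum hsite
  rw [sum_const, hS, nsmul_eq_mul, sum_add_distrib, ← mul_sum, ← mul_sum,
    sum_filter_true_false_sqDiff, sum_comm, ← hD] at hsum
  have hV : ∑ ω ∈ colorSlice S ω₀, ∑ i ∈ S,
      V (ω i) * ∑ j ∈ S.erase i, ∑ k ∈ S.erase i, sqDiff f j k ω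
      = ((a - 1) * sliceLog (a - 1) b + (b - 1) * sliceLog a (b - 1)) * D := by
    rw [hD, mul_sum]
    refine sum_congr rfl fun ω hω => ?_
    rw [sum_mul_sum_erase (fun i => V (ω i)) fun j k => sqDiff f j k ω, mul_sum]
    refine sum_congr rfl fun j hj => ?_
    rw [mul_sum]
    refine sum_congr rfl fun k hk => ?_
    rcases eq_or_ne (ω j) (ω k) with h | h
    · simp [sqDiff_eq_zero h]
    · rw [sum_erase_erase_apply hj hk h, colorCount_eq_of_mem_colorSlice hω,
        colorCount_eq_of_mem_colorSlice hω, mul_comm]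
      rfl
  rw [hV] at hsum
  have hrec' := mul_le_mul_of_nonneg_right hrec hE
  rw [habR] at hrec'
  have hfin : ((n + 1 : ℕ) : ℝ) * entSum (colorSlice S ω₀) (fun ω => f ω ^ 2)
      ≤ (n + 1 : ℕ) * (sliceLog a b / (log 2 * (2 * (n + 1 : ℕ))) * D) := by
    refine hsum.trans ?_
    calc _ ≤ 1 / (log 2 * (2 * n)) * (((n : ℝ) + 1 - 1) * (1 - 1 / (n + 1)) * sliceLog a b * D)
          + sliceLog a b / (log 2 * (n + 1)) * (D / 2) := by gcongr
      _ = _ := by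
        push_cast
        field_simp
        ring
  exact le_of_mul_le_mul_left hfin (by positivity)

end TwoColours
section ManyColours

variable {ι α : Type*} [Fintype ι] [DecidableEq ι] [Fintype α] [DecidableEq α]

theorem sum_mark_fiber_comp_swap {S : Finset ι} {ω₀ : ι → α} (k : α) (η : ι → Bool) {i j : ι}
    (hi : i ∈ S) (hj : j ∈ S) (G : (ι → α) → ℝ) :
    ∑ ω ∈ colorSlice S ω₀ with mark k ω = η, G (ω ∘ Equiv.swap i j)
      = ∑ ω ∈ colorSlice S ω₀ with mark k ω = η ∘ Equiv.swap i j, G ω := by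
  refine sum_nbij' (fun ω => ω ∘ Equiv.swap i j) (fun ω => ω ∘ Equiv.swap i j) ?_ ?_ ?_ ?_ ?_
  · intro ω h
    rw [mem_filter] at h ⊢
    exact ⟨comp_swap_mem_colorSlice h.1 hi hj, by rw [mark_comp_swap, h.2]⟩
  · intro ω h
    rw [mem_filter] at h ⊢
    exact ⟨comp_swap_mem_colorSlice h.1 hi hj, by
      rw [mark_comp_swap, h.2, comp_swap_comp_swap]⟩
  · exact fun ω _ => comp_swap_comp_swap ω i j
  · exact fun ω _ => comp_swap_comp_swap ω i j
  · exact fun ω _ => rfl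

theorem colorCount_mark_true {ι α : Type*} [DecidableEq α] (S : Finset ι) (ω : ι → α) (k : α) :
    colorCount S (mark k ω) true = colorCount S ω k := by
  simp only [colorCount, mark_eq_true]

/-- Entropy of `f ^ 2` on a slice, split along the location of the colour `k`. -/
theorem entSum_colorSlice_le_mark (S : Finset ι) (ω₀ : ι → α) (k : α) (f : (ι → α) → ℝ) :
    entSum (colorSlice S ω₀) (fun ω => f ω ^ 2)
      ≤ ∑ η ∈ colorSlice S (mark k ω₀),
          entSum {ω ∈ colorSlice S ω₀ | mark k ω = η} (fun ω => f ω ^ 2)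
        + sliceLog (colorCount S ω₀ k) (#S - colorCount S ω₀ k) / (log 2 * (2 * #S))
          * ∑ ω ∈ colorSlice S ω₀, ∑ i ∈ S, ∑ j ∈ S,
              if mark k ω i ≠ mark k ω j then sqDiff f i j ω else 0 := by
  have hlog2 : 0 < log 2 := log_pos one_lt_two
  set Ω' := colorSlice S (mark k ω₀) with hΩ'
  let F : (ι → Bool) → Finset (ι → α) := fun η => {ω ∈ colorSlice S ω₀ | mark k ω = η}
  let G : (ι → Bool) → ℝ := fun η => ∑ ω ∈ F η, f ω ^ 2
  have hG : ∀ η, 0 ≤ G η := fun η => sum_nonneg fun _ _ => sq_nonneg _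
  have hmaps : ∀ ω ∈ colorSlice S ω₀, mark k ω ∈ Ω' := fun ω hω => mark_mem_colorSlice hω k
  set M := #(F (mark k ω₀)) with hM
  have hFM : ∀ η ∈ Ω', #(F η) = M := fun η hη => card_mark_fiber_eq hη
  have hMpos : (0 : ℝ) < M :=
    Nat.cast_pos.2 (card_pos.2 ⟨ω₀, mem_filter.2 ⟨self_mem_colorSlice S ω₀, rfl⟩⟩)
  have hcard : (#(colorSlice S ω₀) : ℝ) = M * #Ω' := by
    rw [card_eq_sum_card_fiberwise hmaps, sum_congr rfl hFM, sum_const, smul_eq_mul,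
      Nat.cast_mul, mul_comm]
  have hGsum : ∑ ω ∈ colorSlice S ω₀, f ω ^ 2 = ∑ η ∈ Ω', G η :=
    (sum_fiberwise_of_maps_to hmaps _).symm
  have htwo := entSum_colorSlice_bool_le S (mark k ω₀) fun η => √(G η / M)
  have hcnt : (colorCount S (mark k ω₀) false : ℝ) = #S - colorCount S ω₀ k := by
    rw [← colorCount_true_add_false S (mark k ω₀), colorCount_mark_true]
    push_cast
    ring
  rw [colorCount_mark_true, hcnt, ← hΩ'] at htwo
  have hsq : ∀ η, √(G η / M) ^ 2 = G η / M := fun η => sq_sqrt (div_nonneg (hG η) hMpos.le)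
  have hcoarse : ∑ η ∈ Ω', G η * log (G η / #(F η))
      - (∑ ω ∈ colorSlice S ω₀, f ω ^ 2)
        * log ((∑ ω ∈ colorSlice S ω₀, f ω ^ 2) / #(colorSlice S ω₀))
      = M * entSum Ω' fun η => √(G η / M) ^ 2 := by
    simp only [entSum, hsq]
    rw [hGsum, hcard, ← sum_div, div_div, mul_sub, mul_sum, ← mul_assoc,
      mul_div_cancel₀ _ hMpos.ne']
    congr 1
    refine sum_congr rfl fun η hη => ?_
    rw [hFM η hη, ← mul_assoc, mul_div_cancel₀ _ hMpos.ne']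
  have hdiff : ∀ η ∈ Ω', ∀ i ∈ S, ∀ j ∈ S, M * sqDiff (fun η => √(G η / M)) i j η
      ≤ ∑ ω ∈ F η, if mark k ω i ≠ mark k ω j then sqDiff f i j ω else 0 := by
    intro η hη i hi j hj
    rcases eq_or_ne (η i) (η j) with hij | hij
    · rw [sqDiff_eq_zero hij, mul_zero]
      refine sum_nonneg fun ω _ => ?_
      split_ifs
      exacts [sqDiff_nonneg _ _ _ _, le_rfl]
    · have h := sq_sqrt_sum_sub_sqrt_sum_le (F η) f fun ω => f (ω ∘ Equiv.swap i j)
      rw [sum_mark_fiber_comp_swap k η hi hj fun ω => f ω ^ 2] at h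
      calc (M : ℝ) * sqDiff (fun η => √(G η / M)) i j η
          = (√(G η) - √(G (η ∘ Equiv.swap i j))) ^ 2 := by
            simp only [sqDiff]
            rw [sqrt_div (hG _), sqrt_div (hG _), ← sub_div, div_pow, sq_sqrt hMpos.le,
              mul_div_cancel₀ _ hMpos.ne']
        _ ≤ ∑ ω ∈ F η, (f ω - f (ω ∘ Equiv.swap i j)) ^ 2 := h
        _ = _ := by
            refine sum_congr rfl fun ω hω => ?_
            rw [(mem_filter.1 hω).2, if_pos hij, sqDiff]
  rw [entSum_fiberwise hmaps, add_le_add_iff_left]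
  refine hcoarse.trans_le ?_
  have hw : 0 ≤ sliceLog (colorCount S ω₀ k) (#S - colorCount S ω₀ k) / (log 2 * (2 * #S)) := by
    have hle : (colorCount S ω₀ k : ℝ) ≤ #S := Nat.cast_le.2 (card_filter_le _ _)
    have := sliceLog_nonneg (Nat.cast_nonneg (α := ℝ) (colorCount S ω₀ k)) (sub_nonneg.2 hle)
    positivity
  refine (mul_le_mul_of_nonneg_left htwo hMpos.le).trans ?_
  rw [mul_left_comm]
  refine mul_le_mul_of_nonneg_left ?_ hw
  rw [← sum_fiberwise_of_maps_to hmaps, mul_sum]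
  refine sum_le_sum fun η hη => ?_
  rw [mul_sum, sum_comm]
  refine sum_le_sum fun i hi => ?_
  rw [mul_sum, sum_comm]
  exact sum_le_sum fun j hj => hdiff η hη i hi j hj

theorem sum_ite_merge {α : Type*} [DecidableEq α] (K : Finset α) (A C : α → ℝ) {u v : α}
    (hu : u ∈ K) (hv : v ∈ K)
    (huv : u ≠ v) :
    ∑ k ∈ K, ((if u ≠ k ∧ v ≠ k then A k else 0)
        + if decide (u = k) ≠ decide (v = k) then C k else 0)
      = ∑ k ∈ (K.erase u).erase v, A k + C u + C v := by
  rw [← add_sum_erase K _ hu, ← add_sum_erase (K.erase u) _ (mem_erase.2 ⟨huv.symm, hv⟩)]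
  have h : ∀ k ∈ (K.erase u).erase v, ((if u ≠ k ∧ v ≠ k then A k else 0)
      + if decide (u = k) ≠ decide (v = k) then C k else 0) = A k := by
    intro k hk
    simp only [mem_erase] at hk
    simp [hk.1.symm, hk.2.1.symm]
  rw [sum_congr rfl h]
  simp [huv, huv.symm]
  ring

theorem sum_sum_filter_sqDiff {ι α : Type*} [DecidableEq ι] [DecidableEq α] (S : Finset ι)
    (ω : ι → α) (f : (ι → α) → ℝ) (k : α) :
    ∑ i ∈ S with ω i ≠ k, ∑ j ∈ S with ω j ≠ k, sqDiff f i j ω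
      = ∑ i ∈ S, ∑ j ∈ S, if ω i ≠ k ∧ ω j ≠ k then sqDiff f i j ω else 0 := by
  simp only [sum_filter]
  refine sum_congr rfl fun i _ => ?_
  split_ifs with h <;> simp [h]

/-- Log-Sobolev inequality on a slice whose colours all appear at least `m` times. -/
theorem entSum_colorSlice_le (S : Finset ι) (ω₀ : ι → α) (f : (ι → α) → ℝ) {m : ℝ} (hm : 0 < m)
    (hmS : ∀ i ∈ S, m ≤ colorCount S ω₀ (ω₀ i)) :
    entSum (colorSlice S ω₀) (fun ω => f ω ^ 2)
      ≤ 2 * log (#S / m) / (log 2 * (2 * #S))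
        * ∑ ω ∈ colorSlice S ω₀, ∑ i ∈ S, ∑ j ∈ S, sqDiff f i j ω := by
  induction hn : #(S.image ω₀) using Nat.strong_induction_on generalizing S ω₀ with
  | _ n ih =>
  have hlog2 : 0 < log 2 := log_pos one_lt_two
  by_cases hconst : ∀ i ∈ S, ∀ j ∈ S, ω₀ i = ω₀ j
  · rw [colorSlice_eq_singleton hconst, entSum_singleton]
    rw [sum_singleton, sum_eq_zero fun i hi => sum_eq_zero fun j hj =>
      sqDiff_eq_zero (hconst i hi j hj), mul_zero]
  push Not at hconst
  obtain ⟨i₀, hi₀, j₀, hj₀, hij₀⟩ := hconst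
  set K := S.image ω₀ with hK
  set D := ∑ ω ∈ colorSlice S ω₀, ∑ i ∈ S, ∑ j ∈ S, sqDiff f i j ω with hD
  let κ : α → ℝ := fun k => colorCount S ω₀ k
  have hκm : ∀ k ∈ K, m ≤ κ k := by
    intro k hk
    obtain ⟨i, hi, rfl⟩ := mem_image.1 hk
    exact hmS i hi
  have hκsum : ∑ k ∈ K, κ k = #S := by
    rw [card_eq_sum_card_fiberwise fun i hi => mem_image_of_mem ω₀ hi, Nat.cast_sum]
    rfl
  have hNpos : (0 : ℝ) < #S := Nat.cast_pos.2 (card_pos.2 ⟨i₀, hi₀⟩)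
  have hcolK : ∀ ω ∈ colorSlice S ω₀, ∀ i ∈ S, ω i ∈ K := by
    intro ω hω i hi
    have h : 0 < colorCount S ω (ω i) := card_pos.2 ⟨i, by simp [hi]⟩
    rw [colorCount_eq_of_mem_colorSlice hω] at h
    obtain ⟨j, hj⟩ := card_pos.1 h
    rw [mem_filter] at hj
    exact hj.2 ▸ mem_image_of_mem ω₀ hj.1
  have hKcard : 1 < #K := one_lt_card.2
    ⟨_, mem_image_of_mem ω₀ hi₀, _, mem_image_of_mem ω₀ hj₀, hij₀⟩
  have hκlt : ∀ k ∈ K, 0 < #S - κ k := by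
    intro k hk
    obtain ⟨l, hl, hlk⟩ := exists_mem_ne hKcard k
    have h := single_le_sum (fun c hc => hm.le.trans (hκm c (mem_of_mem_erase hc)))
      (mem_erase.2 ⟨hlk, hl⟩)
    rw [← hκsum, ← add_sum_erase K κ hk]
    linarith [hκm l hl]
  have hfiber : ∀ k ∈ K, ∀ η, entSum {ω ∈ colorSlice S ω₀ | mark k ω = η} (fun ω => f ω ^ 2)
      ≤ 2 * log ((#S - κ k) / m) / (log 2 * (2 * (#S - κ k)))
        * ∑ ω ∈ colorSlice S ω₀ with mark k ω = η, ∑ i ∈ S, ∑ j ∈ S,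
            if ω i ≠ k ∧ ω j ≠ k then sqDiff f i j ω else 0 := by
    intro k hk η
    rcases ({ω ∈ colorSlice S ω₀ | mark k ω = η} : Finset _).eq_empty_or_nonempty with he | he
    · rw [he, entSum_empty, sum_empty, mul_zero]
    obtain ⟨ω, hω⟩ := he
    rw [mem_filter] at hω
    obtain ⟨hω, rfl⟩ := hω
    have hcnt : ∀ c, c ≠ k → colorCount {i ∈ S | ω i ≠ k} ω c = colorCount S ω₀ c := by
      intro c hc
      rw [← colorCount_eq_of_mem_colorSlice hω, colorCount, colorCount, filter_filter]
      congr 1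
      refine filter_congr fun i _ => ⟨fun h => h.2, fun h => ⟨h ▸ hc, h⟩⟩
    have hcardS : (#{i ∈ S | ω i ≠ k} : ℝ) = #S - κ k := by
      have h := card_filter_add_card_filter_not (s := S) (fun i => ω i = k)
      rw [eq_sub_iff_add_eq', ← h, Nat.cast_add, add_left_inj]
      exact congrArg Nat.cast (colorCount_eq_of_mem_colorSlice hω k).symm
    have hlt : #(image ω {i ∈ S | ω i ≠ k}) < n := by
      rw [← hn]
      refine card_lt_card ((Finset.ssubset_iff_of_subset ?_).2 ⟨k, hk, ?_⟩)
      · intro c hc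
        obtain ⟨i, hi, rfl⟩ := mem_image.1 hc
        exact hcolK ω hω i (mem_of_mem_filter i hi)
      · intro hc
        obtain ⟨i, hi, hik⟩ := mem_image.1 hc
        exact (mem_filter.1 hi).2 hik
    have h := ih _ hlt {i ∈ S | ω i ≠ k} ω (fun i hi => by
      rw [mem_filter] at hi
      rw [hcnt _ hi.2]
      exact hκm _ (hcolK ω hω i hi.1)) rfl
    rw [hcardS, ← filter_mark_eq_colorSlice hω] at h
    refine h.trans_eq ?_
    congr 1
    refine sum_congr rfl fun ω' hω' => ?_
    rw [← sum_sum_filter_sqDiff]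
    have hS : {i ∈ S | ω i ≠ k} = {i ∈ S | ω' i ≠ k} := by
      refine filter_congr fun i _ => ?_
      rw [← mark_eq_false, ← mark_eq_false, (mem_filter.1 hω').2]
    rw [hS]
  let A : α → ℝ := fun k => 2 * log ((#S - κ k) / m)
  let C : α → ℝ := fun k => (#S - κ k) * sliceLog (κ k) (#S - κ k) / #S
  have hcolor : ∀ k ∈ K, (#S - κ k) * entSum (colorSlice S ω₀) (fun ω => f ω ^ 2)
      ≤ 1 / (2 * log 2) * ∑ ω ∈ colorSlice S ω₀, ∑ i ∈ S, ∑ j ∈ S,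
          sqDiff f i j ω * ((if ω i ≠ k ∧ ω j ≠ k then A k else 0)
            + if mark k ω i ≠ mark k ω j then C k else 0) := by
    intro k hk
    have h := entSum_colorSlice_le_mark S ω₀ k f
    have h' := sum_le_sum fun η (_ : η ∈ colorSlice S (mark k ω₀)) => hfiber k hk η
    rw [← mul_sum, sum_fiberwise_of_maps_to fun ω hω => mark_mem_colorSlice hω k] at h'
    have h'' := mul_le_mul_of_nonneg_left (h.trans (add_le_add_left h' _)) (hκlt k hk).le
    refine h''.trans_eq ?_
    simp only [mul_add, sum_add_distrib, mul_ite, mul_zero]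
    have e : ∀ (p : (ι → α) → ι → ι → Prop) [∀ ω i j, Decidable (p ω i j)] (c : ℝ),
        ∑ ω ∈ colorSlice S ω₀, ∑ i ∈ S, ∑ j ∈ S, (if p ω i j then sqDiff f i j ω * c else 0)
        = c * ∑ ω ∈ colorSlice S ω₀, ∑ i ∈ S, ∑ j ∈ S,
            if p ω i j then sqDiff f i j ω else 0 := by
      intro p _ c
      rw [mul_comm c]
      simp only [sum_mul, ite_mul, zero_mul]
    rw [e (fun ω i j => ω i ≠ k ∧ ω j ≠ k), e (fun ω i j => mark k ω i ≠ mark k ω j)]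
    have := (hκlt k hk).ne'
    simp only [A, C]
    congr 1
    · field_simp
    · change (#S - κ k) * (sliceLog (κ k) (#S - κ k) / _ * _) = _
      field_simp
  have hsum := sum_le_sum hcolor
  rw [← sum_mul, sum_sub_distrib, sum_const, nsmul_eq_mul, hκsum, ← mul_sum] at hsum
  have hW : ∑ k ∈ K, ∑ ω ∈ colorSlice S ω₀, ∑ i ∈ S, ∑ j ∈ S,
      sqDiff f i j ω * ((if ω i ≠ k ∧ ω j ≠ k then A k else 0)
        + if mark k ω i ≠ mark k ω j then C k else 0)
      ≤ ((#K : ℝ) - 1) * (2 * log (#S / m)) * D := by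
    rw [sum_comm, hD, mul_sum]
    refine sum_le_sum fun ω hω => ?_
    rw [sum_comm, mul_sum]
    refine sum_le_sum fun i hi => ?_
    rw [sum_comm, mul_sum]
    refine sum_le_sum fun j hj => ?_
    rw [← mul_sum, mul_comm]
    rcases eq_or_ne (ω i) (ω j) with hij | hij
    · rw [sqDiff_eq_zero hij, mul_zero, mul_zero]
    · refine mul_le_mul_of_nonneg_right ?_ (sqDiff_nonneg _ _ _ _)
      refine (sum_ite_merge K A C (hcolK ω hω i hi) (hcolK ω hω j hj) hij).trans_le ?_
      exact sum_log_merge_le hm hκm hκsum (hcolK ω hω i hi) (hcolK ω hω j hj) hij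
  have hK1 : (0 : ℝ) < #K - 1 := sub_pos.2 (by exact_mod_cast hKcard)
  have hfin : ((#K : ℝ) - 1) * #S * entSum (colorSlice S ω₀) (fun ω => f ω ^ 2)
      ≤ (#K - 1) * #S * (2 * log (#S / m) / (log 2 * (2 * #S)) * D) := by
    calc _ = ((#K : ℝ) * #S - #S) * entSum (colorSlice S ω₀) (fun ω => f ω ^ 2) := by ring
      _ ≤ _ := hsum
      _ ≤ 1 / (2 * log 2) * (((#K : ℝ) - 1) * (2 * log (#S / m)) * D) := by gcongr
      _ = _ := by field_simp
  exact le_of_mul_le_mul_left hfin (by positivity)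

end ManyColours
section Multislice

theorem gammaSq_eq {N : ℕ} (f : (Fin N → ℝ) → ℝ) (ω : Fin N → ℝ) :
    gammaSq f ω = 1 / (2 * N) * ((∑ i, ∑ j, sqDiff f i j ω) / 2) := by
  rw [gammaSq]
  congr 1
  have h : ∀ i j, (if i < j then sqDiff f i j ω else 0) + (if j < i then sqDiff f j i ω else 0)
      = sqDiff f i j ω := by
    intro i j
    rcases lt_trichotomy i j with hij | rfl | hij
    · simp [hij, hij.not_gt]
    · simp [sqDiff_eq_zero]
    · simp [hij, hij.not_gt, sqDiff_comm f i j]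
  rw [sum_filter, ← univ_product_univ, sum_product, eq_div_iff two_ne_zero, mul_two]
  nth_rw 2 [sum_comm]
  simp only [← sum_add_distrib]
  exact sum_congr rfl fun i _ => sum_congr rfl fun j _ => h i j

theorem multislice_eq_image {L N : ℕ} {κ : Fin L → ℕ} {x : Fin L → ℝ}
    (hx : Function.Injective x) {ω₀ : Fin N → Fin L} (hω₀ : x ∘ ω₀ ∈ multislice L N κ x) :
    multislice L N κ x = (colorSlice univ ω₀).image (x ∘ ·) := by
  have hmem : ∀ ω : Fin N → Fin L, x ∘ ω ∈ multislice L N κ x ↔ ∀ ℓ, #{i | ω i = ℓ} = κ ℓ := by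
    intro ω
    simp [multislice, hx.eq_iff]
  ext η
  rw [mem_image]
  constructor
  · intro hη
    have h := (mem_filter.1 hη).1
    simp only [Fintype.mem_piFinset, mem_image, mem_univ, true_and] at h
    choose ω hω using h
    obtain rfl : x ∘ ω = η := funext hω
    refine ⟨ω, mem_colorSlice.2 ⟨by simp, fun c => ?_⟩, rfl⟩
    rw [(hmem _).1 hη, (hmem _).1 hω₀]
  · rintro ⟨ω, hω, rfl⟩
    refine (hmem ω).2 fun ℓ => ?_
    rw [(mem_colorSlice.1 hω).2, (hmem _).1 hω₀]

theorem exists_comp_mem_multislice {L N : ℕ} {κ : Fin L → ℕ} {x : Fin L → ℝ}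
    (h : (multislice L N κ x).Nonempty) :
    ∃ ω₀ : Fin N → Fin L, x ∘ ω₀ ∈ multislice L N κ x := by
  obtain ⟨η, hη⟩ := h
  have h := (mem_filter.1 hη).1
  simp only [Fintype.mem_piFinset, mem_image, mem_univ, true_and] at h
  choose ω hω using h
  exact ⟨ω, (funext hω : x ∘ ω = η) ▸ hη⟩

end Multislice

/-- Logarithmic Sobolev inequality for the multislice. -/
theorem stmt13 (L N : ℕ) (hL : 2 ≤ L) (κ : Fin L → ℕ) (hκ : ∀ ℓ, 1 ≤ κ ℓ)
    (hN : N = ∑ ℓ, κ ℓ) (x : Fin L → ℝ) (hx : StrictMono x)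
    (f : (Fin N → ℝ) → ℝ) :
    uent (multislice L N κ x) (fun ω => f ω ^ 2) ≤
      (4 * Real.log ((N : ℝ) / (⨅ ℓ : Fin L, (κ ℓ : ℝ))) / Real.log 2) *
        uexpect (multislice L N κ x) (gammaSq f) := by
  rcases (multislice L N κ x).eq_empty_or_nonempty with he | hne
  · simp [he, uent, uexpect]
  obtain ⟨ω₀, hω₀⟩ := exists_comp_mem_multislice hne
  have himage := multislice_eq_image hx.injective hω₀
  have hcnt : ∀ ℓ, colorCount univ ω₀ ℓ = κ ℓ := by
    intro ℓ
    rw [← (mem_filter.1 hω₀).2 ℓ]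
    simp [colorCount, hx.injective.eq_iff]
  have : Nonempty (Fin L) := ⟨⟨0, by omega⟩⟩
  set m : ℝ := ⨅ ℓ : Fin L, (κ ℓ : ℝ) with hm
  have hm1 : 1 ≤ m := le_ciInf fun ℓ => by exact_mod_cast hκ ℓ
  have hmle : ∀ ℓ, m ≤ κ ℓ := fun ℓ => ciInf_le (Set.finite_range _).bddBelow ℓ
  have key := entSum_colorSlice_le univ ω₀ (fun ω => f (x ∘ ω)) (zero_lt_one.trans_le hm1)
    fun i _ => by rw [hcnt]; exact hmle _
  rw [card_univ, Fintype.card_fin] at key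
  have hcard : (0 : ℝ) < #(multislice L N κ x) := Nat.cast_pos.2 hne.card_pos
  have hinj : Function.Injective fun ω : Fin N → Fin L => x ∘ ω := hx.injective.comp_left
  refine le_of_mul_le_mul_left ?_ hcard
  rw [card_mul_uent _ hne, mul_left_comm, uexpect, mul_div_cancel₀ _ hcard.ne', himage,
    entSum_image _ _ hinj, sum_image hinj.injOn]
  refine key.trans_eq ?_
  simp only [gammaSq_eq, ← mul_sum, ← sum_div]
  change _ = 4 * log (N / m) / log 2 * (1 / (2 * N) * ((∑ ω ∈ colorSlice univ ω₀, ∑ i, ∑ j,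
    sqDiff (fun ω => f (x ∘ ω)) i j ω) / 2))
  ring
end
end

section
/- (Modified log-Sobolev inequalities for the multislice.) For every function f : Ω_κ → ℝ, Ent_{P_κ}(e^f) ≤ 2 · E_κ[ Γ(f)² e^f ] (Γ-mLSI with σ² = 4), and Ent_{P_κ}(e^f) ≤ 4 · E_κ[ Γ⁺(f)² e^f ] (Γ⁺-mLSI with σ² = 8). -/
open Finset Real
open scoped Classical

noncomputable section

/-- The permutations of `ι` that fix every point outside `A`. -/
def permsOn {ι : Type*} [Fintype ι] [DecidableEq ι] (A : Finset ι) : Finset (Equiv.Perm ι) :=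
  Finset.univ.filter fun h => ∀ i, i ∉ A → h i = i

/-- The average of `g` over all rearrangements of the coordinates in `A`. -/
def permAverage {ι β : Type*} [Fintype ι] [DecidableEq ι] (A : Finset ι)
    (g : (ι → β) → ℝ) (ω : ι → β) : ℝ :=
  (∑ h ∈ permsOn A, g (ω ∘ h)) / (permsOn A).card

section PermAverage

variable {ι β : Type*} [Fintype ι] [DecidableEq ι]

theorem mem_permsOn {A : Finset ι} {h : Equiv.Perm ι} :
    h ∈ permsOn A ↔ ∀ i, i ∉ A → h i = i := by
  simp [permsOn]

theorem one_mem_permsOn (A : Finset ι) : (1 : Equiv.Perm ι) ∈ permsOn A :=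
  mem_permsOn.2 fun _ _ => rfl

theorem mul_mem_permsOn {A : Finset ι} {h k : Equiv.Perm ι} (hh : h ∈ permsOn A)
    (hk : k ∈ permsOn A) : h * k ∈ permsOn A :=
  mem_permsOn.2 fun i hi => by
    rw [Equiv.Perm.mul_apply, mem_permsOn.1 hk i hi, mem_permsOn.1 hh i hi]

theorem inv_mem_permsOn {A : Finset ι} {h : Equiv.Perm ι} (hh : h ∈ permsOn A) :
    h⁻¹ ∈ permsOn A :=
  mem_permsOn.2 fun i hi => by
    rw [Equiv.Perm.inv_eq_iff_eq, mem_permsOn.1 hh i hi]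

theorem permsOn_mono {A B : Finset ι} (hAB : A ⊆ B) : permsOn A ⊆ permsOn B := fun _ hh =>
  mem_permsOn.2 fun i hi => mem_permsOn.1 hh i fun hiA => hi (hAB hiA)

theorem swap_mem_permsOn {A : Finset ι} {i j : ι} (hi : i ∈ A) (hj : j ∈ A) :
    Equiv.swap i j ∈ permsOn A :=
  mem_permsOn.2 fun _ hk => Equiv.swap_apply_of_ne_of_ne
    (fun h => hk (h ▸ hi)) (fun h => hk (h ▸ hj))

theorem apply_mem_iff_of_mem_permsOn {A : Finset ι} {h : Equiv.Perm ι} (hh : h ∈ permsOn A)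
    (j : ι) : h j ∈ A ↔ j ∈ A := by
  constructor
  · intro hj
    by_contra hjA
    rw [mem_permsOn.1 hh j hjA] at hj
    exact hjA hj
  · intro hj
    by_contra hjA
    rw [h.injective (mem_permsOn.1 hh _ hjA)] at hjA
    exact hjA hj

theorem permsOn_empty : permsOn (∅ : Finset ι) = {1} := by
  ext h
  simp [mem_permsOn, Equiv.ext_iff]

theorem permsOn_univ : permsOn (Finset.univ : Finset ι) = Finset.univ := by
  ext h
  simp [mem_permsOn]

theorem card_permsOn_pos (A : Finset ι) : (0 : ℝ) < (permsOn A).card :=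
  Nat.cast_pos.2 (Finset.card_pos.2 ⟨1, one_mem_permsOn A⟩)

/-- Decomposition of the permutations of `A` according to the image of `i`. -/
theorem sum_permsOn_eq_sum_swap_mul {M : Type*} [AddCommMonoid M] {A : Finset ι} {i : ι}
    (hi : i ∈ A) (F : Equiv.Perm ι → M) :
    ∑ h ∈ permsOn A, F h =
      ∑ k ∈ A, ∑ η ∈ permsOn (A.erase i), F (Equiv.swap i k * η) := by
  have hfix : ∀ η ∈ permsOn (A.erase i), η i = i := fun η hη =>
    mem_permsOn.1 hη i (Finset.notMem_erase i A)
  rw [← Finset.sum_product']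
  refine (Finset.sum_bij' (fun p _ => Equiv.swap i p.1 * p.2)
    (fun h _ => (h i, Equiv.swap i (h i) * h)) ?_ ?_ ?_ ?_ ?_).symm
  · rintro ⟨_, η⟩ hp
    rw [Finset.mem_product] at hp
    exact mul_mem_permsOn (swap_mem_permsOn hi hp.1)
      (permsOn_mono (Finset.erase_subset i A) hp.2)
  · intro h hh
    have hA := (apply_mem_iff_of_mem_permsOn hh i).2 hi
    refine Finset.mem_product.2 ⟨hA, mem_permsOn.2 fun j hj => ?_⟩
    by_cases hji : j = i
    · simp [hji]
    · have hjA : j ∉ A := fun hjA => hj (Finset.mem_erase.2 ⟨hji, hjA⟩)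
      exact mem_permsOn.1 (mul_mem_permsOn (swap_mem_permsOn hi hA) hh) j hjA
  · rintro ⟨k, η⟩ hp
    rw [Finset.mem_product] at hp
    have := hfix η hp.2
    ext <;> simp [this]
  · intro h hh
    simp
  · intro p hp
    rfl

theorem card_permsOn_eq_mul {A : Finset ι} {i : ι} (hi : i ∈ A) :
    (permsOn A).card = A.card * (permsOn (A.erase i)).card := by
  simpa using sum_permsOn_eq_sum_swap_mul hi (fun _ => (1 : ℕ))

theorem permAverage_pos (A : Finset ι) {g : (ι → β) → ℝ} (hg : ∀ ω, 0 < g ω) (ω : ι → β) :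
    0 < permAverage A g ω :=
  div_pos (Finset.sum_pos (fun _ _ => hg _) ⟨1, one_mem_permsOn A⟩) (card_permsOn_pos A)

theorem permAverage_empty (g : (ι → β) → ℝ) (ω : ι → β) : permAverage ∅ g ω = g ω := by
  simp [permAverage, permsOn_empty]

theorem permAverage_comp {A : Finset ι} {k : Equiv.Perm ι} (hk : k ∈ permsOn A)
    (g : (ι → β) → ℝ) (ω : ι → β) : permAverage A g (ω ∘ k) = permAverage A g ω := by
  unfold permAverage
  congr 1
  refine Finset.sum_bij' (fun h _ => k * h) (fun h _ => k⁻¹ * h) ?_ ?_ ?_ ?_ ?_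
  · exact fun h hh => mul_mem_permsOn hk hh
  · exact fun h hh => mul_mem_permsOn (inv_mem_permsOn hk) hh
  · intro h _; simp
  · intro h _; simp
  · intro h _; rfl

theorem permAverage_eq_sum_erase {A : Finset ι} {i : ι} (hi : i ∈ A) (g : (ι → β) → ℝ)
    (ω : ι → β) : permAverage A g ω =
      (∑ k ∈ A, permAverage (A.erase i) g (ω ∘ Equiv.swap i k)) / A.card := by
  unfold permAverage
  rw [sum_permsOn_eq_sum_swap_mul hi, card_permsOn_eq_mul hi, ← Finset.sum_div, div_div,
    Nat.cast_mul, mul_comm (A.card : ℝ)]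
  rfl

omit [Fintype ι] [DecidableEq ι] in
theorem sum_comp_perm {Ω : Finset (ι → β)} (hΩ : ∀ (h : Equiv.Perm ι), ∀ ω ∈ Ω, ω ∘ h ∈ Ω)
    (h : Equiv.Perm ι) (F : (ι → β) → ℝ) : ∑ ω ∈ Ω, F (ω ∘ h) = ∑ ω ∈ Ω, F ω := by
  refine Finset.sum_bij' (fun ω _ => ω ∘ h) (fun ω _ => ω ∘ (h⁻¹ : Equiv.Perm ι))
    (hΩ h) (hΩ h⁻¹) ?_ ?_ ?_
  · intro ω _; ext; simp
  · intro ω _; ext; simp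
  · intro ω _; rfl

omit [Fintype ι] in
/-- The swap-invariance of sums, in the form used for symmetrization. -/
theorem sum_swap_symm {Ω : Finset (ι → β)} (hΩ : ∀ (h : Equiv.Perm ι), ∀ ω ∈ Ω, ω ∘ h ∈ Ω)
    (i j : ι) (F : (ι → β) → (ι → β) → ℝ) :
    ∑ ω ∈ Ω, F (ω ∘ Equiv.swap i j) ω = ∑ ω ∈ Ω, F ω (ω ∘ Equiv.swap i j) := by
  rw [← sum_comp_perm hΩ (Equiv.swap i j)]
  refine Finset.sum_congr rfl fun ω _ => ?_
  rw [Function.comp_assoc, ← Equiv.Perm.coe_mul, Equiv.swap_mul_self, Equiv.Perm.coe_one,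
    Function.comp_id]

end PermAverage

/-- The log-sum inequality. -/
theorem sum_mul_log_sub_log_le {α : Type*} {s : Finset α} (hs : s.Nonempty) {u v : α → ℝ}
    (hu : ∀ a, 0 < u a) (hv : ∀ a, 0 < v a) :
    (∑ a ∈ s, u a) * (Real.log (∑ a ∈ s, u a) - Real.log (∑ a ∈ s, v a)) ≤
      ∑ a ∈ s, u a * (Real.log (u a) - Real.log (v a)) := by
  set U := ∑ a ∈ s, u a with hU
  set V := ∑ a ∈ s, v a with hV
  have hU0 : 0 < U := Finset.sum_pos (fun a _ => hu a) hs
  have hV0 : 0 < V := Finset.sum_pos (fun a _ => hv a) hs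
  have key : ∀ a ∈ s, u a * (Real.log U - Real.log V) + u a - v a * (U / V) ≤
      u a * (Real.log (u a) - Real.log (v a)) := by
    intro a _
    have h := Real.log_le_sub_one_of_pos
      (div_pos (mul_pos (hv a) hU0) (mul_pos (hu a) hV0))
    rw [Real.log_div (mul_pos (hv a) hU0).ne' (mul_pos (hu a) hV0).ne',
      Real.log_mul (hv a).ne' hU0.ne', Real.log_mul (hu a).ne' hV0.ne'] at h
    have h2 := mul_le_mul_of_nonneg_left h (hu a).le
    have h3 : u a * (v a * U / (u a * V) - 1) = v a * (U / V) - u a := by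
      have := (hu a).ne'
      field_simp
    rw [h3] at h2
    linarith
  have hsum := Finset.sum_le_sum key
  rw [Finset.sum_sub_distrib, Finset.sum_add_distrib, ← Finset.sum_mul, ← Finset.sum_mul,
    ← hU, ← hV, mul_div_cancel₀ _ hV0.ne'] at hsum
  linarith

theorem two_sub_mul_exp_le {t : ℝ} (ht : 0 ≤ t) : (2 - t) * Real.exp t ≤ 2 + t := by
  have hd : ∀ s : ℝ, HasDerivAt (fun s => 2 + s - (2 - s) * Real.exp s)
      (1 - (1 - s) * Real.exp s) s := by
    intro s
    exact (((hasDerivAt_id' s).const_add 2).sub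
      (((hasDerivAt_id' s).const_sub 2).mul (Real.hasDerivAt_exp s))).congr_deriv (by ring)
  have hmono : Monotone fun s : ℝ => 2 + s - (2 - s) * Real.exp s := by
    refine monotone_of_deriv_nonneg (fun s => (hd s).differentiableAt) fun s => ?_
    rw [(hd s).deriv, sub_nonneg]
    calc (1 - s) * Real.exp s ≤ Real.exp (-s) * Real.exp s :=
          mul_le_mul_of_nonneg_right (Real.one_sub_le_exp_neg s) (Real.exp_pos s).le
      _ = 1 := by rw [← Real.exp_add, neg_add_cancel, Real.exp_zero]
  have := hmono ht
  simp only [Real.exp_zero] at this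
  linarith

theorem exp_sub_exp_mul_sub_le (a b : ℝ) :
    (Real.exp a - Real.exp b) * (a - b) ≤
      (a - b) ^ 2 * (Real.exp a + Real.exp b) / 2 := by
  wlog hab : b ≤ a generalizing a b
  · have := this b a (le_of_not_ge hab)
    linarith
  have h := two_sub_mul_exp_le (sub_nonneg.2 hab)
  have hexp : Real.exp a = Real.exp (a - b) * Real.exp b := by
    rw [← Real.exp_add, sub_add_cancel]
  have h2 := mul_le_mul_of_nonneg_left
    (mul_le_mul_of_nonneg_right h (Real.exp_pos b).le) (sub_nonneg.2 hab)
  rw [mul_assoc, ← hexp] at h2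
  linarith

theorem exp_sub_exp_mul_sub_le_posPart (a b : ℝ) :
    (Real.exp a - Real.exp b) * (a - b) ≤
      (max (a - b) 0) ^ 2 * Real.exp a + (max (b - a) 0) ^ 2 * Real.exp b := by
  wlog hab : b ≤ a generalizing a b
  · have := this b a (le_of_not_ge hab)
    linarith
  rw [max_eq_left (sub_nonneg.2 hab), max_eq_right (sub_nonpos.2 hab)]
  have h := mul_le_mul_of_nonneg_right (Real.one_sub_le_exp_neg (a - b)) (Real.exp_pos a).le
  rw [← Real.exp_add, neg_sub, sub_add_cancel] at h
  have h2 := mul_le_mul_of_nonneg_left h (sub_nonneg.2 hab)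
  linarith

section Entropy

variable {ι β : Type*} [Fintype ι] [DecidableEq ι]

theorem permAverage_mul_log_sub_log_le (A : Finset ι) {g : (ι → β) → ℝ} (hg : ∀ ω, 0 < g ω)
    (ω ω' : ι → β) :
    permAverage A g ω * (Real.log (permAverage A g ω) - Real.log (permAverage A g ω')) ≤
      (∑ h ∈ permsOn A, g (ω ∘ h) * (Real.log (g (ω ∘ h)) - Real.log (g (ω' ∘ h)))) /
        (permsOn A).card := by
  have hne : (permsOn A).Nonempty := ⟨1, one_mem_permsOn A⟩
  have hc := card_permsOn_pos A
  have h1 : ∀ ω : ι → β, 0 < ∑ h ∈ permsOn A, g (ω ∘ h) := fun ω =>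
    Finset.sum_pos (fun _ _ => hg _) hne
  unfold permAverage
  rw [Real.log_div (h1 ω).ne' hc.ne', Real.log_div (h1 ω').ne' hc.ne', sub_sub_sub_cancel_right,
    div_mul_eq_mul_div]
  exact div_le_div_of_nonneg_right
    (sum_mul_log_sub_log_le hne (fun h => hg (ω ∘ h)) (fun h => hg (ω' ∘ h))) hc.le

/-- The relative-entropy-type energy of `g` along the transposition of `i` and `j`. -/
def swapEnergy (Ω : Finset (ι → β)) (g : (ι → β) → ℝ) (i j : ι) : ℝ :=
  ∑ ω ∈ Ω, g ω * (Real.log (g ω) - Real.log (g (ω ∘ Equiv.swap i j)))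

omit [Fintype ι] in
theorem swapEnergy_self (Ω : Finset (ι → β)) (g : (ι → β) → ℝ) (i : ι) :
    swapEnergy Ω g i i = 0 := by
  simp [swapEnergy]

omit [Fintype ι] in
theorem swapEnergy_comm (Ω : Finset (ι → β)) (g : (ι → β) → ℝ) (i j : ι) :
    swapEnergy Ω g i j = swapEnergy Ω g j i := by
  simp only [swapEnergy, Equiv.swap_comm i j]

variable {Ω : Finset (ι → β)}

omit [Fintype ι] in
theorem two_mul_swapEnergy (hΩ : ∀ (h : Equiv.Perm ι), ∀ ω ∈ Ω, ω ∘ h ∈ Ω)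
    (g : (ι → β) → ℝ) (i j : ι) :
    2 * swapEnergy Ω g i j = ∑ ω ∈ Ω, (g ω - g (ω ∘ Equiv.swap i j)) *
      (Real.log (g ω) - Real.log (g (ω ∘ Equiv.swap i j))) := by
  have h := sum_swap_symm hΩ i j (fun ω ω' => g ω * (Real.log (g ω) - Real.log (g ω')))
  rw [two_mul]
  nth_rewrite 2 [swapEnergy]
  rw [← h, swapEnergy, ← Finset.sum_add_distrib]
  exact Finset.sum_congr rfl fun ω _ => by ring

omit [Fintype ι] in
theorem swapEnergy_nonneg (hΩ : ∀ (h : Equiv.Perm ι), ∀ ω ∈ Ω, ω ∘ h ∈ Ω)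
    {g : (ι → β) → ℝ} (hg : ∀ ω, 0 < g ω) (i j : ι) : 0 ≤ swapEnergy Ω g i j := by
  have h : 0 ≤ 2 * swapEnergy Ω g i j := by
    rw [two_mul_swapEnergy hΩ]
    refine Finset.sum_nonneg fun ω _ => ?_
    rcases le_total (g ω) (g (ω ∘ Equiv.swap i j)) with h | h
    · exact mul_nonneg_of_nonpos_of_nonpos (sub_nonpos.2 h)
        (sub_nonpos.2 (Real.log_le_log (hg _) h))
    · exact mul_nonneg (sub_nonneg.2 h) (sub_nonneg.2 (Real.log_le_log (hg _) h))
  linarith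

theorem sum_swapEnergy_permAverage_erase_le (hΩ : ∀ (h : Equiv.Perm ι), ∀ ω ∈ Ω, ω ∘ h ∈ Ω)
    {g : (ι → β) → ℝ} (hg : ∀ ω, 0 < g ω) (A : Finset ι) (i : ι) :
    ∑ l ∈ A, swapEnergy Ω (permAverage (A.erase i) g) i l ≤ ∑ l ∈ A, swapEnergy Ω g i l := by
  have hc := card_permsOn_pos (A.erase i)
  have hconj : ∀ η ∈ permsOn (A.erase i), ∀ (ω : ι → β) (l : ι),
      (ω ∘ Equiv.swap i l) ∘ η = (ω ∘ η) ∘ Equiv.swap i (η⁻¹ l) := by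
    intro η hη ω l
    have hfix : η⁻¹ i = i :=
      mem_permsOn.1 (inv_mem_permsOn hη) i (Finset.notMem_erase i A)
    have := Equiv.swap_apply_apply η⁻¹ i l
    rw [hfix] at this
    rw [this]
    funext j
    simp
  have hmem : ∀ η ∈ permsOn (A.erase i), ∀ l, l ∈ A ↔ η⁻¹ l ∈ A := fun η hη l =>
    (apply_mem_iff_of_mem_permsOn
      (inv_mem_permsOn (permsOn_mono (Finset.erase_subset i A) hη)) l).symm
  calc ∑ l ∈ A, swapEnergy Ω (permAverage (A.erase i) g) i l
      ≤ ∑ l ∈ A, ∑ ω ∈ Ω, (∑ η ∈ permsOn (A.erase i), g (ω ∘ η) * (Real.log (g (ω ∘ η)) -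
          Real.log (g ((ω ∘ η) ∘ Equiv.swap i (η⁻¹ l))))) / (permsOn (A.erase i)).card := by
        refine Finset.sum_le_sum fun l _ => Finset.sum_le_sum fun ω _ => ?_
        refine (permAverage_mul_log_sub_log_le (A.erase i) hg ω _).trans_eq ?_
        congr 1
        exact Finset.sum_congr rfl fun η hη => by rw [hconj η hη]
    _ = ∑ l ∈ A, (∑ η ∈ permsOn (A.erase i), swapEnergy Ω g i (η⁻¹ l)) /
          (permsOn (A.erase i)).card := by
        refine Finset.sum_congr rfl fun l _ => ?_
        rw [← Finset.sum_div, Finset.sum_comm]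
        congr 1
        exact Finset.sum_congr rfl fun η _ => sum_comp_perm hΩ η
          (fun ω => g ω * (Real.log (g ω) - Real.log (g (ω ∘ Equiv.swap i (η⁻¹ l)))))
    _ = (∑ η ∈ permsOn (A.erase i), ∑ l ∈ A, swapEnergy Ω g i l) /
          (permsOn (A.erase i)).card := by
        rw [← Finset.sum_div, Finset.sum_comm]
        congr 1
        exact Finset.sum_congr rfl fun η hη => Finset.sum_equiv η⁻¹ (hmem η hη) fun _ _ => rfl
    _ = ∑ l ∈ A, swapEnergy Ω g i l := by
        rw [Finset.sum_const, nsmul_eq_mul, mul_div_cancel_left₀ _ hc.ne']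

/-- The entropy of a function of a single coordinate is controlled by its covariance with its
logarithm, hence by the energies of the transpositions moving that coordinate. -/
theorem sum_permAverage_erase_mul_log_sub_le (hΩ : ∀ (h : Equiv.Perm ι), ∀ ω ∈ Ω, ω ∘ h ∈ Ω)
    {g : (ι → β) → ℝ} (hg : ∀ ω, 0 < g ω) {A : Finset ι} {i : ι} (hi : i ∈ A) :
    ∑ ω ∈ Ω, permAverage (A.erase i) g ω * Real.log (permAverage (A.erase i) g ω) -
      ∑ ω ∈ Ω, permAverage A g ω * Real.log (permAverage A g ω) ≤
      (∑ l ∈ A, swapEnergy Ω g i l) / A.card := by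
  set k := permAverage (A.erase i) g with hk
  set m := permAverage A g with hm
  have hk0 : ∀ ω, 0 < k ω := permAverage_pos _ hg
  have hm0 : ∀ ω, 0 < m ω := permAverage_pos _ hg
  have hn : (0 : ℝ) < A.card := Nat.cast_pos.2 (Finset.card_pos.2 ⟨i, hi⟩)
  have hmk : ∀ ω, m ω = (∑ l ∈ A, k (ω ∘ Equiv.swap i l)) / A.card :=
    permAverage_eq_sum_erase hi g
  have hjensen : ∀ ω, (∑ l ∈ A, Real.log (k (ω ∘ Equiv.swap i l))) / A.card ≤
      Real.log (m ω) := by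
    intro ω
    have hs := sum_mul_log_sub_log_le (s := A) ⟨i, hi⟩ (u := fun _ => (1 : ℝ))
      (v := fun l => k (ω ∘ Equiv.swap i l)) (fun _ => one_pos) (fun _ => hk0 _)
    have hV : 0 < ∑ l ∈ A, k (ω ∘ Equiv.swap i l) :=
      Finset.sum_pos (fun _ _ => hk0 _) ⟨i, hi⟩
    rw [hmk, Real.log_div hV.ne' hn.ne', div_le_iff₀ hn]
    simp only [Finset.sum_const, nsmul_eq_mul, mul_one, Real.log_one, zero_sub, one_mul,
      Finset.sum_neg_distrib] at hs
    linarith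
  have hcross : ∑ ω ∈ Ω, (∑ l ∈ A, k ω * Real.log (k (ω ∘ Equiv.swap i l))) / A.card ≤
      ∑ ω ∈ Ω, m ω * Real.log (m ω) := by
    calc ∑ ω ∈ Ω, (∑ l ∈ A, k ω * Real.log (k (ω ∘ Equiv.swap i l))) / A.card
        = ∑ ω ∈ Ω, m ω * Real.log (k ω) := by
          simp only [hmk, ← Finset.sum_div, div_mul_eq_mul_div, Finset.sum_mul]
          congr 1
          rw [Finset.sum_comm, Finset.sum_comm (s := Ω)]
          exact Finset.sum_congr rfl fun l _ =>
            (sum_swap_symm hΩ i l fun ω ω' => k ω * Real.log (k ω')).symm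
      _ = ∑ ω ∈ Ω, m ω * ((∑ l ∈ A, Real.log (k (ω ∘ Equiv.swap i l))) / A.card) := by
          have h1 : ∀ l ∈ A, ∑ ω ∈ Ω, m ω * Real.log (k (ω ∘ Equiv.swap i l)) =
              ∑ ω ∈ Ω, m ω * Real.log (k ω) := by
            intro l hl
            rw [← sum_comp_perm hΩ (Equiv.swap i l) fun ω => m ω * Real.log (k ω)]
            refine Finset.sum_congr rfl fun ω _ => ?_
            rw [hm, permAverage_comp (swap_mem_permsOn hi hl)]
          simp only [← mul_div_assoc, ← Finset.sum_div, Finset.mul_sum]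
          rw [Finset.sum_comm, Finset.sum_congr rfl h1, Finset.sum_const, nsmul_eq_mul,
            mul_div_cancel_left₀ _ hn.ne']
      _ ≤ ∑ ω ∈ Ω, m ω * Real.log (m ω) :=
          Finset.sum_le_sum fun ω _ => mul_le_mul_of_nonneg_left (hjensen ω) (hm0 ω).le
  have hself : ∑ l ∈ A, swapEnergy Ω k i l = A.card * ∑ ω ∈ Ω, k ω * Real.log (k ω) -
      ∑ ω ∈ Ω, ∑ l ∈ A, k ω * Real.log (k (ω ∘ Equiv.swap i l)) := by
    simp only [swapEnergy, mul_sub, Finset.sum_sub_distrib, Finset.sum_const, nsmul_eq_mul]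
    rw [Finset.sum_comm]
  have hle := sum_swapEnergy_permAverage_erase_le hΩ hg A i
  rw [← hk, hself] at hle
  rw [← Finset.sum_div, div_le_iff₀ hn] at hcross
  rw [le_div_iff₀ hn]
  linarith

omit [Fintype ι] in
theorem sum_sum_erase_eq {A : Finset ι} {F : ι → ι → ℝ} (hF : ∀ i, F i i = 0) :
    ∑ i ∈ A, ∑ j ∈ A.erase i, ∑ k ∈ A.erase i, F j k =
      ((A.card : ℝ) - 2) * ∑ j ∈ A, ∑ k ∈ A, F j k := by
  have h1 : ∀ i ∈ A, ∑ j ∈ A.erase i, ∑ k ∈ A.erase i, F j k =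
      ∑ j ∈ A, ∑ k ∈ A, F j k - ∑ k ∈ A, F i k - ∑ j ∈ A, F j i := by
    intro i hi
    have h2 : ∀ j, ∑ k ∈ A.erase i, F j k = ∑ k ∈ A, F j k - F j i := fun j =>
      Finset.sum_erase_eq_sub hi
    simp only [h2]
    rw [Finset.sum_sub_distrib, Finset.sum_erase_eq_sub hi, Finset.sum_erase_eq_sub hi, hF]
    ring
  rw [Finset.sum_congr rfl h1, Finset.sum_sub_distrib, Finset.sum_sub_distrib, Finset.sum_const,
    nsmul_eq_mul, Finset.sum_comm (f := fun i j => F j i)]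
  ring

/-- The entropy produced by averaging over rearrangements of the coordinates in `A`. -/
theorem sum_mul_log_sub_permAverage_le (hΩ : ∀ (h : Equiv.Perm ι), ∀ ω ∈ Ω, ω ∘ h ∈ Ω)
    {g : (ι → β) → ℝ} (hg : ∀ ω, 0 < g ω) (A : Finset ι) :
    ∑ ω ∈ Ω, g ω * Real.log (g ω) -
      ∑ ω ∈ Ω, permAverage A g ω * Real.log (permAverage A g ω) ≤
      (∑ i ∈ A, ∑ j ∈ A, swapEnergy Ω g i j) / A.card := by
  induction hn : A.card generalizing A with
  | zero =>
    rw [Finset.card_eq_zero] at hn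
    simp [hn, permAverage_empty]
  | succ n ih =>
    have hS : 0 ≤ ∑ i ∈ A, ∑ j ∈ A, swapEnergy Ω g i j :=
      Finset.sum_nonneg fun i _ => Finset.sum_nonneg fun j _ => swapEnergy_nonneg hΩ hg i j
    have hstep : ∀ i ∈ A, ∑ ω ∈ Ω, g ω * Real.log (g ω) -
        ∑ ω ∈ Ω, permAverage A g ω * Real.log (permAverage A g ω) ≤
        (∑ j ∈ A.erase i, ∑ k ∈ A.erase i, swapEnergy Ω g j k) / n +
          (∑ l ∈ A, swapEnergy Ω g i l) / A.card := by
      intro i hi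
      have h1 := ih (A.erase i) (by rw [Finset.card_erase_of_mem hi, hn]; rfl)
      have h2 := sum_permAverage_erase_mul_log_sub_le hΩ hg hi
      linarith
    have hsum := Finset.sum_le_sum hstep
    rw [Finset.sum_const, nsmul_eq_mul, Finset.sum_add_distrib, ← Finset.sum_div,
      ← Finset.sum_div, sum_sum_erase_eq (swapEnergy_self Ω g), hn] at hsum
    set S := ∑ i ∈ A, ∑ j ∈ A, swapEnergy Ω g i j
    push_cast at hsum ⊢
    have hn1 : (0 : ℝ) < n + 1 := by positivity
    rw [le_div_iff₀ hn1, mul_comm]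
    refine hsum.trans ?_
    rcases Nat.eq_zero_or_pos n with rfl | hpos
    · simp
    · have hp : (0 : ℝ) < n := Nat.cast_pos.2 hpos
      have hcoef : ((n : ℝ) + 1 - 2) / n + 1 / (n + 1) ≤ 1 := by
        rw [div_add_div _ _ hp.ne' hn1.ne', div_le_one (by positivity)]
        nlinarith
      calc ((n : ℝ) + 1 - 2) * S / n + S / (n + 1)
          = (((n : ℝ) + 1 - 2) / n + 1 / (n + 1)) * S := by ring
        _ ≤ 1 * S := mul_le_mul_of_nonneg_right hcoef hS
        _ = S := one_mul S

/-- Modified logarithmic Sobolev inequality on a finite set of vectors on which the group of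
coordinate permutations acts transitively. -/
theorem uent_le_sum_swapEnergy (hΩ : ∀ (h : Equiv.Perm ι), ∀ ω ∈ Ω, ω ∘ h ∈ Ω)
    (htrans : ∀ ω ∈ Ω, ∀ ω' ∈ Ω, ∃ h : Equiv.Perm ι, ω' = ω ∘ h)
    {g : (ι → β) → ℝ} (hg : ∀ ω, 0 < g ω) :
    uent Ω g ≤ (∑ i, ∑ j, swapEnergy Ω g i j) / Fintype.card ι / Ω.card := by
  rcases Ω.eq_empty_or_nonempty with rfl | hne
  · simp [uent, uexpect]
  have hc : (0 : ℝ) < Ω.card := Nat.cast_pos.2 (Finset.card_pos.2 hne)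
  have hconst : ∀ ω ∈ Ω, permAverage Finset.univ g ω = uexpect Ω g := by
    intro ω₀ hω₀
    have h1 : ∀ ω ∈ Ω, permAverage Finset.univ g ω = permAverage Finset.univ g ω₀ := by
      intro ω hω
      obtain ⟨h, rfl⟩ := htrans ω₀ hω₀ ω hω
      exact permAverage_comp (by simp [permsOn_univ]) g ω₀
    have h2 : ∑ ω ∈ Ω, permAverage Finset.univ g ω = ∑ ω ∈ Ω, g ω := by
      simp only [permAverage]
      rw [← Finset.sum_div, Finset.sum_comm,
        Finset.sum_congr rfl fun h _ => sum_comp_perm hΩ h g, Finset.sum_const, nsmul_eq_mul,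
        mul_div_cancel_left₀ _ (card_permsOn_pos _).ne']
    rw [Finset.sum_congr rfl h1, Finset.sum_const, nsmul_eq_mul] at h2
    rw [uexpect, ← h2, mul_div_cancel_left₀ _ hc.ne']
  have h := sum_mul_log_sub_permAverage_le hΩ hg Finset.univ
  have hmean : ∑ ω ∈ Ω, permAverage Finset.univ g ω * Real.log (permAverage Finset.univ g ω) =
      Ω.card * (uexpect Ω g * Real.log (uexpect Ω g)) := by
    rw [← nsmul_eq_mul, ← Finset.sum_const]
    exact Finset.sum_congr rfl fun ω hω => by rw [hconst ω hω]
  rw [hmean, Finset.card_univ] at h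
  rw [le_div_iff₀ hc]
  refine le_trans (le_of_eq ?_) h
  rw [uent, sub_mul, uexpect, div_mul_cancel₀ _ hc.ne', mul_comm (Ω.card : ℝ)]

omit [Fintype ι] in
theorem swapEnergy_exp_le_sq (hΩ : ∀ (h : Equiv.Perm ι), ∀ ω ∈ Ω, ω ∘ h ∈ Ω)
    (f : (ι → β) → ℝ) (i j : ι) :
    2 * swapEnergy Ω (fun ω => Real.exp (f ω)) i j ≤
      ∑ ω ∈ Ω, (f ω - f (ω ∘ Equiv.swap i j)) ^ 2 * Real.exp (f ω) := by
  have h := sum_swap_symm hΩ i j (fun ω ω' => (f ω - f ω') ^ 2 * Real.exp (f ω))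
  have hle : 2 * swapEnergy Ω (fun ω => Real.exp (f ω)) i j ≤
      ∑ ω ∈ Ω, ((f ω - f (ω ∘ Equiv.swap i j)) ^ 2 * Real.exp (f ω) +
        (f (ω ∘ Equiv.swap i j) - f ω) ^ 2 * Real.exp (f (ω ∘ Equiv.swap i j))) / 2 := by
    rw [two_mul_swapEnergy hΩ]
    refine Finset.sum_le_sum fun ω _ => ?_
    rw [Real.log_exp, Real.log_exp]
    linarith [exp_sub_exp_mul_sub_le (f ω) (f (ω ∘ Equiv.swap i j))]
  rw [← Finset.sum_div, Finset.sum_add_distrib] at hle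
  linarith

omit [Fintype ι] in
theorem swapEnergy_exp_le_posPart_sq (hΩ : ∀ (h : Equiv.Perm ι), ∀ ω ∈ Ω, ω ∘ h ∈ Ω)
    (f : (ι → β) → ℝ) (i j : ι) :
    swapEnergy Ω (fun ω => Real.exp (f ω)) i j ≤
      ∑ ω ∈ Ω, (max (f ω - f (ω ∘ Equiv.swap i j)) 0) ^ 2 * Real.exp (f ω) := by
  have h := sum_swap_symm hΩ i j (fun ω ω' => (max (f ω - f ω') 0) ^ 2 * Real.exp (f ω))
  have hle : 2 * swapEnergy Ω (fun ω => Real.exp (f ω)) i j ≤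
      ∑ ω ∈ Ω, ((max (f ω - f (ω ∘ Equiv.swap i j)) 0) ^ 2 * Real.exp (f ω) +
        (max (f (ω ∘ Equiv.swap i j) - f ω) 0) ^ 2 * Real.exp (f (ω ∘ Equiv.swap i j))) := by
    rw [two_mul_swapEnergy hΩ]
    refine Finset.sum_le_sum fun ω _ => ?_
    rw [Real.log_exp, Real.log_exp]
    exact exp_sub_exp_mul_sub_le_posPart (f ω) (f (ω ∘ Equiv.swap i j))
  rw [Finset.sum_add_distrib] at hle
  linarith

end Entropy

theorem sum_sum_eq_two_mul_sum_lt {ι : Type*} [Fintype ι] [LinearOrder ι] {F : ι → ι → ℝ}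
    (hF : ∀ i, F i i = 0) (hsymm : ∀ i j, F i j = F j i) :
    ∑ i, ∑ j, F i j =
      2 * ∑ q ∈ (Finset.univ : Finset (ι × ι)).filter (fun q => q.1 < q.2), F q.1 q.2 := by
  have hsplit : ∀ i j, F i j = (if i < j then F i j else 0) + if j < i then F j i else 0 := by
    intro i j
    rcases lt_trichotomy i j with h | rfl | h
    · simp [h, h.not_gt]
    · simp [hF]
    · simp [h, h.not_gt, hsymm i j]
  have hlt : ∑ q ∈ (Finset.univ : Finset (ι × ι)).filter (fun q => q.1 < q.2), F q.1 q.2 =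
      ∑ i, ∑ j, if i < j then F i j else 0 := by
    rw [Finset.sum_filter, Fintype.sum_prod_type]
  rw [hlt, Finset.sum_congr rfl fun i _ => Finset.sum_congr rfl fun j _ => hsplit i j]
  simp only [Finset.sum_add_distrib]
  rw [Finset.sum_comm (f := fun i j => if j < i then F j i else 0)]
  ring

theorem exists_perm_comp_eq {ι β : Type*} [Fintype ι] {u v : ι → β}
    (huv : ∀ c, (Finset.univ.filter fun i => u i = c).card =
      (Finset.univ.filter fun i => v i = c).card) :
    ∃ h : Equiv.Perm ι, v = u ∘ h := by
  have he : ∀ c, Nonempty ({i // v i = c} ≃ {i // u i = c}) := fun c => by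
    rw [← Fintype.card_eq, Fintype.card_subtype, Fintype.card_subtype, huv]
  exact ⟨Equiv.ofFiberEquiv fun c => (he c).some,
    funext fun i => (Equiv.ofFiberEquiv_map _ i).symm⟩

theorem comp_perm_mem_multislice {L N : ℕ} {κ : Fin L → ℕ} {x : Fin L → ℝ}
    (h : Equiv.Perm (Fin N)) (ω : Fin N → ℝ) (hω : ω ∈ multislice L N κ x) :
    ω ∘ h ∈ multislice L N κ x := by
  rw [multislice, Finset.mem_filter, Fintype.mem_piFinset] at hω ⊢
  refine ⟨fun i => hω.1 (h i), fun ℓ => ?_⟩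
  rw [← hω.2 ℓ]
  exact Finset.card_equiv h fun i => by simp

theorem exists_perm_of_mem_multislice {L N : ℕ} {κ : Fin L → ℕ} {x : Fin L → ℝ}
    (ω : Fin N → ℝ) (hω : ω ∈ multislice L N κ x) (ω' : Fin N → ℝ)
    (hω' : ω' ∈ multislice L N κ x) : ∃ h : Equiv.Perm (Fin N), ω' = ω ∘ h := by
  rw [multislice, Finset.mem_filter, Fintype.mem_piFinset] at hω hω'
  refine exists_perm_comp_eq fun c => ?_
  by_cases hc : ∃ ℓ, x ℓ = c
  · obtain ⟨ℓ, rfl⟩ := hc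
    rw [hω.2, hω'.2]
  · have hempty : ∀ u : Fin N → ℝ, (∀ i, u i ∈ Finset.image x Finset.univ) →
        (Finset.univ.filter fun i => u i = c) = ∅ := fun u hu =>
      Finset.filter_eq_empty_iff.2 fun i _ hi => hc (by simpa [hi] using hu i)
    rw [hempty ω hω.1, hempty ω' hω'.1]

/-- Integrating a modified logarithmic Sobolev inequality from its bound on each transposition. -/
theorem uent_exp_le_of_swapEnergy_le {N : ℕ} {Ω : Finset (Fin N → ℝ)}
    (hΩ : ∀ (h : Equiv.Perm (Fin N)), ∀ ω ∈ Ω, ω ∘ h ∈ Ω)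
    (htrans : ∀ ω ∈ Ω, ∀ ω' ∈ Ω, ∃ h : Equiv.Perm (Fin N), ω' = ω ∘ h)
    (f : (Fin N → ℝ) → ℝ) (c : ℝ) (D : (Fin N → ℝ) → Fin N × Fin N → ℝ)
    (hD : ∀ q : Fin N × Fin N, 2 * swapEnergy Ω (fun ω => Real.exp (f ω)) q.1 q.2 ≤
      c / 2 * ∑ ω ∈ Ω, D ω q * Real.exp (f ω)) :
    uent Ω (fun ω => Real.exp (f ω)) ≤ c * uexpect Ω (fun ω => (1 / (2 * (N : ℝ)) *
      ∑ q ∈ (Finset.univ : Finset (Fin N × Fin N)).filter (fun q => q.1 < q.2), D ω q) *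
        Real.exp (f ω)) := by
  refine (uent_le_sum_swapEnergy hΩ htrans fun ω => Real.exp_pos (f ω)).trans ?_
  rw [sum_sum_eq_two_mul_sum_lt (swapEnergy_self _ _) (swapEnergy_comm _ _), Finset.mul_sum,
    Fintype.card_fin]
  have hsum := Finset.sum_le_sum (s := (Finset.univ : Finset (Fin N × Fin N)).filter
    (fun q => q.1 < q.2)) fun q _ => hD q
  calc _ ≤ (∑ q ∈ (Finset.univ : Finset (Fin N × Fin N)).filter (fun q => q.1 < q.2),
        c / 2 * ∑ ω ∈ Ω, D ω q * Real.exp (f ω)) / N / Ω.card := by gcongr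
    _ = _ := by
      simp only [uexpect, mul_assoc, ← Finset.mul_sum, Finset.sum_mul]
      rw [Finset.sum_comm]
      ring

/-- Modified logarithmic Sobolev inequalities for the multislice:
a `Γ`-mLSI with constant `σ² = 4` and a `Γ⁺`-mLSI with constant `σ² = 8`. -/
theorem stmt14 (L N : ℕ) (hL : 2 ≤ L) (κ : Fin L → ℕ) (hκ : ∀ ℓ, 1 ≤ κ ℓ)
    (hN : N = ∑ ℓ, κ ℓ) (x : Fin L → ℝ) (hx : StrictMono x)
    (f : (Fin N → ℝ) → ℝ) :
    uent (multislice L N κ x) (fun ω => Real.exp (f ω)) ≤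
      2 * uexpect (multislice L N κ x) (fun ω => gammaSq f ω * Real.exp (f ω)) ∧
    uent (multislice L N κ x) (fun ω => Real.exp (f ω)) ≤
      4 * uexpect (multislice L N κ x) (fun ω => gammaPlusSq f ω * Real.exp (f ω)) := by
  constructor
  · refine uent_exp_le_of_swapEnergy_le comp_perm_mem_multislice exists_perm_of_mem_multislice
      f 2 (fun ω q => (f ω - f (ω ∘ Equiv.swap q.1 q.2)) ^ 2) fun q => ?_
    have := swapEnergy_exp_le_sq comp_perm_mem_multislice (Ω := multislice L N κ x) f q.1 q.2
    linarith
  · refine uent_exp_le_of_swapEnergy_le comp_perm_mem_multislice exists_perm_of_mem_multislice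
      f 4 (fun ω q => (max (f ω - f (ω ∘ Equiv.swap q.1 q.2)) 0) ^ 2) fun q => ?_
    have := swapEnergy_exp_le_posPart_sq comp_perm_mem_multislice (Ω := multislice L N κ x)
      f q.1 q.2
    linarith
end
end
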